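/- Fix an integer k ≥ 3 and N ≥ 1. The number of 2-regular, k-noncrossing partitions of [N] equals the number of loop-free B_{W_{k−1}}-walks of length 2(N−1) that start at δ = (k−2,k−3,…,1,0) and end at δ. -/

import Mathlib

open Finset

/-- Lattice points in `ℤ^(k-1)`; coordinate `i : Fin (k-1)` represents `ν_{i+1}`. -/
abbrev Pt (k : ℕ) := Fin (k - 1) → ℤ

/-- The starting point `δ = (k-2, k-3, …, 1, 0)`. -/
def delta (k : ℕ) : Pt k := fun i => (k : ℤ) - 2 - (i : ℤ)

/-- Membership in `Q_{k-1}`: all coordinates nonnegative. -/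
def inQ {k : ℕ} (v : Pt k) : Prop := ∀ i, 0 ≤ v i

/-- Membership in `W_{k-1}`: `ν_1 > ν_2 > ⋯ > ν_{k-1} ≥ 0`. -/
def inW {k : ℕ} (v : Pt k) : Prop := StrictAnti v ∧ ∀ i, 0 ≤ v i

/-- `eVec k i` is `e_i`: `e_0 = 0` and for `1 ≤ i ≤ k-1`, `e_i` is the `i`-th
standard basis vector of `ℤ^(k-1)`. -/
def eVec (k : ℕ) (i : Fin k) : Pt k := fun j => if (j : ℕ) + 1 = (i : ℕ) then 1 else 0

/-- The vector `e_1`. -/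
def eOne (k : ℕ) : Pt k := fun j => if (j : ℕ) = 0 then 1 else 0

/-- A step in `{+e_i : 0 ≤ i ≤ k-1}`. -/
def plusStep {k : ℕ} (d : Pt k) : Prop := ∃ i : Fin k, d = eVec k i

/-- A step in `{-e_i : 0 ≤ i ≤ k-1}`. -/
def minusStep {k : ℕ} (d : Pt k) : Prop := ∃ i : Fin k, d = -eVec k i

/-- A `𝒫_D`-walk of length `ℓ`: starts at `δ`, stays in `D`, odd steps are `-e_i`,
even steps are `+e_i`. -/
def IsPWalk {k : ℕ} (D : Pt k → Prop) (ℓ : ℕ) (v : Fin (ℓ + 1) → Pt k) : Prop :=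
  v ⟨0, Nat.succ_pos ℓ⟩ = delta k ∧ (∀ t, D (v t)) ∧
    ∀ t : ℕ, ∀ h : t + 1 < ℓ + 1,
      (Odd (t + 1) → minusStep (v ⟨t + 1, h⟩ - v ⟨t, by omega⟩)) ∧
      (Even (t + 1) → plusStep (v ⟨t + 1, h⟩ - v ⟨t, by omega⟩))

/-- A `ℬ_D`-walk of length `ℓ`: starts at `δ`, stays in `D`, odd steps are `+e_i`,
even steps are `-e_i`. -/
def IsBWalk {k : ℕ} (D : Pt k → Prop) (ℓ : ℕ) (v : Fin (ℓ + 1) → Pt k) : Prop :=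
  v ⟨0, Nat.succ_pos ℓ⟩ = delta k ∧ (∀ t, D (v t)) ∧
    ∀ t : ℕ, ∀ h : t + 1 < ℓ + 1,
      (Odd (t + 1) → plusStep (v ⟨t + 1, h⟩ - v ⟨t, by omega⟩)) ∧
      (Even (t + 1) → minusStep (v ⟨t + 1, h⟩ - v ⟨t, by omega⟩))

/-- A walk is loop-free if no odd/even step pair `(+e_1, -e_1)` occurs. -/
def LoopFree {k ℓ : ℕ} (v : Fin (ℓ + 1) → Pt k) : Prop :=
  ∀ q : ℕ, 1 ≤ q → ∀ h : 2 * q < ℓ + 1,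
    ¬ (v ⟨2 * q - 1, by omega⟩ - v ⟨2 * q - 2, by omega⟩ = eOne k ∧
       v ⟨2 * q, h⟩ - v ⟨2 * q - 1, by omega⟩ = -eOne k)

/-- `a^ν_{k,ℓ}`: the number of `𝒫_{Q_{k-1}}`-walks of length `ℓ` ending at `ν`. -/
noncomputable def aCount (k ℓ : ℕ) (ν : Pt k) : ℕ :=
  Nat.card {v : Fin (ℓ + 1) → Pt k //
    IsPWalk (inQ (k := k)) ℓ v ∧ v (Fin.last ℓ) = ν}

/-- `ω^ν_{k,ℓ}`: the number of `𝒫_{W_{k-1}}`-walks of length `ℓ` ending at `ν`. -/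
noncomputable def omegaCount (k ℓ : ℕ) (ν : Pt k) : ℕ :=
  Nat.card {v : Fin (ℓ + 1) → Pt k //
    IsPWalk (inW (k := k)) ℓ v ∧ v (Fin.last ℓ) = ν}

/-- `σ^ν_{k,ℓ}`: the number of `ℬ_{W_{k-1}}`-walks of length `ℓ` ending at `ν`. -/
noncomputable def sigmaCount (k ℓ : ℕ) (ν : Pt k) : ℕ :=
  Nat.card {v : Fin (ℓ + 1) → Pt k //
    IsBWalk (inW (k := k)) ℓ v ∧ v (Fin.last ℓ) = ν}

/-- `σ^{ν;*}_{k,ℓ}`: the number of loop-free `ℬ_{W_{k-1}}`-walks of length `ℓ`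
ending at `ν`. -/
noncomputable def sigmaStarCount (k ℓ : ℕ) (ν : Pt k) : ℕ :=
  Nat.card {v : Fin (ℓ + 1) → Pt k //
    IsBWalk (inW (k := k)) ℓ v ∧ LoopFree v ∧ v (Fin.last ℓ) = ν}

/-- `(a,b)` is an arc of the standard representation of the partition `P`:
`a < b`, `a` and `b` lie in a common block `B`, and no element of `B` lies
strictly between them. -/
def IsArc {N : ℕ} (P : Finpartition (Finset.univ : Finset (Fin N))) (a b : Fin N) : Prop :=
  a < b ∧ ∃ B ∈ P.parts, a ∈ B ∧ b ∈ B ∧ ∀ c ∈ B, ¬(a < c ∧ c < b)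

/-- The partition `P` has a `k`-crossing: arcs `(i₁,j₁),…,(i_k,j_k)` with
`i₁ < ⋯ < i_k < j₁ < ⋯ < j_k`. -/
def PartitionHasKCrossing {N : ℕ} (k : ℕ)
    (P : Finpartition (Finset.univ : Finset (Fin N))) : Prop :=
  ∃ ii jj : Fin k → Fin N, (∀ m, IsArc P (ii m) (jj m)) ∧
    StrictMono ii ∧ StrictMono jj ∧ ∀ m m', ii m < jj m'

/-- The partition `P` is `2`-regular: distinct elements of a common block differ
by at least `2`. -/
def TwoRegular {N : ℕ} (P : Finpartition (Finset.univ : Finset (Fin N))) : Prop :=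
  ∀ B ∈ P.parts, ∀ x ∈ B, ∀ y ∈ B, x ≠ y → 2 ≤ |((x : ℕ) : ℤ) - ((y : ℕ) : ℤ)|

/-- A braid over `[N]`, given by its arc set: arcs `(i,j)` with `i ≤ j` (loops
allowed), each vertex is the smaller endpoint of at most one arc and the larger
endpoint of at most one arc. -/
def IsBraid {N : ℕ} (A : Finset (Fin N × Fin N)) : Prop :=
  (∀ p ∈ A, p.1 ≤ p.2) ∧ (∀ p ∈ A, ∀ q ∈ A, p.1 = q.1 → p = q) ∧
    (∀ p ∈ A, ∀ q ∈ A, p.2 = q.2 → p = q)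

/-- The braid with arc set `A` has a `k`-crossing: arcs `(i₁,j₁),…,(i_k,j_k)`
with `i₁ < ⋯ < i_k ≤ j₁ < ⋯ < j_k`. -/
def BraidHasKCrossing {N : ℕ} (k : ℕ) (A : Finset (Fin N × Fin N)) : Prop :=
  ∃ ii jj : Fin k → Fin N, (∀ m, (ii m, jj m) ∈ A) ∧
    StrictMono ii ∧ StrictMono jj ∧ ∀ m m', ii m ≤ jj m'

/-- A braid is loop-free if it has no arc `(i,i)`. -/
def BraidLoopFree {N : ℕ} (A : Finset (Fin N × Fin N)) : Prop :=
  ∀ p ∈ A, p.1 ≠ p.2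

namespace BraidWalk

/-- The length of a longest strictly increasing sublist all of whose entries are at least `b`. -/
def lis : ℕ → List ℕ → ℕ
  | _, [] => 0
  | b, s :: S => if b ≤ s then max (lis b S) (1 + lis (s + 1) S) else lis b S

/-- One pass of row insertion over a word of row indices: `bump c S` scans `S` from left to right
carrying a row index, initially `c`; whenever the carried index is met, it is increased by one and
the entry met is replaced by the new value. Returns the new word and the final carried index. -/
def bump : ℕ → List ℕ → List ℕ × ℕ
  | c, [] => ([], c)
  | c, s :: S =>
    if s = c then ((c + 1) :: (bump (c + 1) S).1, (bump (c + 1) S).2)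
    else (s :: (bump c S).1, (bump c S).2)

/-- Row insertion of the label `a` into the tableau whose entry `i` lies in row `T[i - 1]`, where
row `0` stands for absence. Returns the new tableau and the row of the new box. Inserting `0` does
nothing. -/
def insertLabel : ℕ → List ℕ → List ℕ × ℕ
  | 0, T => (T, 0)
  | _ + 1, [] => ([], 0)
  | 1, _ :: T => (1 :: (bump 1 T).1, (bump 1 T).2)
  | a + 2, s :: T => (s :: (insertLabel (a + 1) T).1, (insertLabel (a + 1) T).2)

/-- The lattice word condition: every prefix contains `r + 1` at most as often as `r ≥ 1`. -/
def IsLatticeWord (T : List ℕ) : Prop :=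
  ∀ n r, 1 ≤ r → (T.take n).count (r + 1) ≤ (T.take n).count r

theorem lis_anti {b b' : ℕ} (h : b ≤ b') (S : List ℕ) : lis b' S ≤ lis b S := by
  induction S with
  | nil => simp [lis]
  | cons s S ih => simp only [lis]; split_ifs <;> omega

theorem lis_le_one_add_lis_succ (b : ℕ) (S : List ℕ) : lis b S ≤ 1 + lis (b + 1) S := by
  induction S with
  | nil => simp [lis]
  | cons s S ih =>
    simp only [lis]
    split_ifs with h1 h2
    · omega
    · obtain rfl : s = b := by omega
      omega
    · omega
    · omega

theorem length_le_lis {b : ℕ} {l S : List ℕ} (hl : l.Sublist S) (hb : ∀ t ∈ l, b ≤ t)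
    (hs : l.Pairwise (· < ·)) : l.length ≤ lis b S := by
  induction hl generalizing b with
  | slnil => simp
  | cons s h ih =>
    have := ih hb hs
    simp only [lis]; split_ifs <;> omega
  | cons_cons s h ih =>
    rw [List.pairwise_cons] at hs
    have := ih (b := s + 1) (fun t ht => hs.1 t ht) hs.2
    have hbs : b ≤ s := hb s (by simp)
    simp only [lis, hbs, if_true, List.length_cons]; omega

theorem exists_sublist_of_le_lis (b : ℕ) (S : List ℕ) : ∀ n ≤ lis b S,
    ∃ l : List ℕ, l.Sublist S ∧ (∀ t ∈ l, b ≤ t) ∧ l.Pairwise (· < ·) ∧ l.length = n := by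
  induction S generalizing b with
  | nil =>
    intro n hn
    simp only [lis, Nat.le_zero] at hn
    exact ⟨[], by simp [hn]⟩
  | cons s S ih =>
    intro n hn
    by_cases h : n ≤ lis b S
    · obtain ⟨l, h1, h2⟩ := ih b n h
      exact ⟨l, h1.cons s, h2⟩
    · simp only [lis] at hn
      split_ifs at hn with hbs
      · obtain ⟨l, h1, h2, h3, h4⟩ := ih (s + 1) (n - 1) (by omega)
        refine ⟨s :: l, h1.cons_cons s, ?_, ?_, ?_⟩
        · intro t ht
          rcases List.mem_cons.1 ht with rfl | ht
          · exact hbs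
          · have := h2 t ht; omega
        · exact List.pairwise_cons.2 ⟨fun t ht => h2 t ht, h3⟩
        · simp only [List.length_cons]; omega
      · omega

theorem lis_bump (S : List ℕ) (c : ℕ) :
    (∀ b ≤ c, lis b (bump c S).1 = lis b S) ∧ lis (c + 1) (bump c S).1 = lis c S ∧
    ∀ b, c < b → lis b S ≤ lis b (bump c S).1 ∧
      (lis b (bump c S).1 ≤ lis b S ∨ lis b (bump c S).1 + (b - c - 1) ≤ lis c S) := by
  induction S generalizing c with
  | nil => simp [bump, lis]
  | cons s S ih =>
    by_cases hsc : s = c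
    · subst hsc
      obtain ⟨h1, h2, h3⟩ := ih (s + 1)
      have h4 := lis_le_one_add_lis_succ s S
      simp only [bump, if_true, lis]
      refine ⟨fun b hb => ?_, ?_, fun b hb => ?_⟩
      · rw [if_pos (by omega), if_pos hb, h1 b (by omega), h2]
      · rw [if_pos le_rfl, if_pos le_rfl, h1 _ le_rfl, h2]; omega
      · rw [if_neg (by omega : ¬ b ≤ s), if_pos le_rfl]
        split_ifs with hbs
        · obtain rfl : b = s + 1 := by omega
          rw [h1 _ le_rfl, h2]; omega
        · have := h3 b (by omega); omega
    · obtain ⟨h1, h2, h3⟩ := ih c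
      simp only [bump, if_neg hsc, lis]
      refine ⟨fun b hb => ?_, ?_, fun b hb => ?_⟩
      · have ha := lis_anti hb S
        split_ifs with hbs
        · rw [h1 b hb]
          rcases lt_or_gt_of_ne hsc with h | h
          · rw [h1 _ (by omega)]
          · have := h3 (s + 1) (by omega); omega
        · exact h1 b hb
      · rcases lt_or_gt_of_ne hsc with h | h
        · rw [if_neg (by omega), if_neg (by omega), h2]
        · rw [if_pos (by omega), if_pos (by omega), h2]
          have := h3 (s + 1) (by omega); omega
      · have hb3 := h3 b hb
        by_cases hbs : b ≤ s
        · have hs3 := h3 (s + 1) (by omega)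
          rw [if_pos hbs, if_pos hbs, if_pos (by omega)]; omega
        · rw [if_neg hbs, if_neg hbs]
          split_ifs <;> omega

theorem lis_insertLabel (T : List ℕ) (a : ℕ) (ha : T[a]? = some 0) :
    lis 1 (insertLabel (a + 1) T).1 = max (lis 1 T) (1 + lis 1 (T.drop (a + 1))) ∧
    ∀ b, 1 ≤ b → lis b T ≤ lis b (insertLabel (a + 1) T).1 ∧
      (lis b (insertLabel (a + 1) T).1 ≤ lis b T ∨
        lis b (insertLabel (a + 1) T).1 + (b - 1) ≤ 1 + lis 1 (T.drop (a + 1))) := by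
  induction T generalizing a with
  | nil => simp at ha
  | cons s T ih =>
    cases a with
    | zero =>
      obtain rfl : s = 0 := by simpa using ha
      obtain ⟨h1, h2, h3⟩ := lis_bump T 1
      simp only [insertLabel, lis, List.drop_succ_cons, List.drop_zero]
      refine ⟨?_, fun b hb => ?_⟩
      · simp [h1, h2]
      · rw [if_neg (by omega)]
        split_ifs with hb1
        · obtain rfl : b = 1 := by omega
          rw [h1 _ le_rfl, h2]; omega
        · have := h3 b (by omega); omega
    | succ a =>
      obtain ⟨h1, h2⟩ := ih a (by simpa using ha)
      simp only [insertLabel, lis, List.drop_succ_cons]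
      have hs := h2 (s + 1) (by omega)
      refine ⟨?_, fun b hb => ?_⟩
      · split_ifs <;> omega
      · have := h2 b hb
        split_ifs <;> omega

theorem length_bump (c : ℕ) (S : List ℕ) : (bump c S).1.length = S.length := by
  induction S generalizing c with
  | nil => simp [bump]
  | cons s S ih => simp only [bump]; split_ifs <;> simp [ih]

theorem length_insertLabel (a : ℕ) (T : List ℕ) : (insertLabel a T).1.length = T.length := by
  fun_induction insertLabel a T <;> simp_all [length_bump]

theorem bump_concat (c : ℕ) (S : List ℕ) (s : ℕ) :
    bump c (S ++ [s]) = if s = (bump c S).2 then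
      ((bump c S).1 ++ [(bump c S).2 + 1], (bump c S).2 + 1)
      else ((bump c S).1 ++ [s], (bump c S).2) := by
  induction S generalizing c with
  | nil => simp only [List.nil_append, bump]; split_ifs with h <;> simp [h]
  | cons t S ih =>
    simp only [List.cons_append, bump, ih]
    split_ifs <;> simp_all

theorem insertLabel_concat {a : ℕ} {T : List ℕ} (s : ℕ) (ha : a < T.length) :
    insertLabel (a + 1) (T ++ [s]) = if s = (insertLabel (a + 1) T).2 then
      ((insertLabel (a + 1) T).1 ++ [(insertLabel (a + 1) T).2 + 1],
        (insertLabel (a + 1) T).2 + 1)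
      else ((insertLabel (a + 1) T).1 ++ [s], (insertLabel (a + 1) T).2) := by
  induction T generalizing a with
  | nil => simp at ha
  | cons t T ih =>
    cases a with
    | zero =>
      simp only [List.cons_append, insertLabel, bump_concat]
      split_ifs with h <;> simp [h]
    | succ a =>
      simp only [List.cons_append, insertLabel, ih (by simpa using ha)]
      split_ifs with h <;> simp [h]

theorem insertLabel_length_concat (T : List ℕ) (s : ℕ) :
    insertLabel (T.length + 1) (T ++ [s]) = (T ++ [1], 1) := by
  induction T with
  | nil => simp [insertLabel, bump]
  | cons t T ih => simp [insertLabel, ih]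

theorem dropLast_insertLabel_concat {a : ℕ} {T : List ℕ} (s : ℕ) (ha : a ≤ T.length) :
    (insertLabel a (T ++ [s])).1.dropLast = (insertLabel a T).1 := by
  cases a with
  | zero => simp [insertLabel]
  | succ a =>
    rw [insertLabel_concat s ha]
    split_ifs <;> simp

theorem bump_snd_pos {c : ℕ} (hc : 1 ≤ c) (S : List ℕ) : 1 ≤ (bump c S).2 := by
  induction S generalizing c with
  | nil => simpa [bump]
  | cons s S ih =>
    simp only [bump]; split_ifs
    · exact ih (by omega)
    · exact ih hc

theorem insertLabel_snd_pos {a : ℕ} {T : List ℕ} (ha : a < T.length) :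
    1 ≤ (insertLabel (a + 1) T).2 := by
  induction T generalizing a with
  | nil => simp at ha
  | cons t T ih =>
    cases a with
    | zero => exact bump_snd_pos le_rfl T
    | succ a => exact ih (by simpa using ha)

theorem isLatticeWord_concat {T : List ℕ} {s : ℕ} : IsLatticeWord (T ++ [s]) ↔
    IsLatticeWord T ∧ ∀ r, 1 ≤ r → (T ++ [s]).count (r + 1) ≤ (T ++ [s]).count r := by
  constructor
  · intro h
    refine ⟨fun n r hr => ?_, fun r hr => ?_⟩
    · have := h (min n T.length) r hr
      rw [List.take_append_of_le_length (by omega)] at this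
      rcases le_total n T.length with h | h
      · rwa [min_eq_left h] at this
      · rw [min_eq_right h, List.take_length] at this
        rwa [List.take_of_length_le h]
    · have := h (T ++ [s]).length r hr
      rwa [List.take_length] at this
  · rintro ⟨h1, h2⟩ n r hr
    rcases le_or_gt n T.length with h | h
    · rw [List.take_append_of_le_length h]; exact h1 n r hr
    · rw [List.take_of_length_le (by simpa using h)]; exact h2 r hr

theorem IsLatticeWord.count_succ_le {T : List ℕ} (h : IsLatticeWord T) {r : ℕ} (hr : 1 ≤ r) :
    T.count (r + 1) ≤ T.count r := by
  simpa using h T.length r hr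

theorem count_concat (T : List ℕ) (s r : ℕ) :
    (T ++ [s]).count r = T.count r + if s = r then 1 else 0 := by
  simp [List.count_append, List.count_singleton]

theorem IsLatticeWord.insertLabel {T : List ℕ} (hT : IsLatticeWord T) {a : ℕ}
    (ha : T[a]? = some 0) :
    IsLatticeWord (insertLabel (a + 1) T).1 ∧
    ∀ r, 1 ≤ r → (BraidWalk.insertLabel (a + 1) T).1.count r =
      T.count r + if r = (BraidWalk.insertLabel (a + 1) T).2 then 1 else 0 := by
  induction T using List.reverseRecOn generalizing a with
  | nil => simp at ha
  | append_singleton T s ih =>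
    rw [isLatticeWord_concat] at hT
    obtain ⟨hT, hs⟩ := hT
    rcases lt_or_ge a T.length with hlt | hge
    · rw [List.getElem?_append_left hlt] at ha
      obtain ⟨h1, h2⟩ := ih hT ha
      have hc := insertLabel_snd_pos hlt
      rw [insertLabel_concat s hlt]
      generalize hq : BraidWalk.insertLabel (a + 1) T = q at *
      obtain ⟨T', c⟩ := q
      simp only at h1 h2 hc ⊢
      split_ifs with hsc
      · subst hsc
        simp only
        rw [isLatticeWord_concat]
        refine ⟨⟨h1, fun r hr => ?_⟩, fun r hr => ?_⟩
        · have e1 := h2 r hr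
          have e2 := h2 (r + 1) (by omega)
          have e3 := hT.count_succ_le hr
          have e4 := h1.count_succ_le hr
          rw [count_concat, count_concat]
          split_ifs at * <;> omega
        · rw [count_concat, count_concat, h2 r hr]
          split_ifs <;> omega
      · simp only
        rw [isLatticeWord_concat]
        refine ⟨⟨h1, fun r hr => ?_⟩, fun r hr => ?_⟩
        · have e1 := h2 r hr
          have e2 := h2 (r + 1) (by omega)
          have e3 := hs r hr
          have e4 := h1.count_succ_le hr
          rw [count_concat, count_concat] at *
          split_ifs at * <;> omega
        · rw [count_concat, count_concat, h2 r hr]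
          split_ifs <;> omega
    · obtain rfl : a = T.length := by
        have := (List.getElem?_eq_some_iff.1 ha).1
        simp at this; omega
      obtain rfl : s = 0 := by simpa using ha
      rw [insertLabel_length_concat]
      simp only
      rw [isLatticeWord_concat]
      refine ⟨⟨hT, fun r hr => ?_⟩, fun r hr => ?_⟩
      · have := hT.count_succ_le hr
        rw [count_concat, count_concat]
        split_ifs <;> omega
      · rw [count_concat, count_concat]
        split_ifs <;> omega

theorem exists_insertLabel_eq {T' : List ℕ} (hT' : IsLatticeWord T') {c : ℕ} (hc : 1 ≤ c)
    (hlt : T'.count (c + 1) < T'.count c) :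
    ∃ a T, T[a]? = some 0 ∧ insertLabel (a + 1) T = (T', c) ∧ IsLatticeWord T := by
  induction T' using List.reverseRecOn generalizing c with
  | nil => simp at hlt
  | append_singleton T' s ih =>
    rw [isLatticeWord_concat] at hT'
    obtain ⟨hT', hs⟩ := hT'
    by_cases hsc : s = c
    · subst hsc
      obtain rfl | ⟨c, rfl, hc1⟩ : s = 1 ∨ ∃ c, s = c + 1 ∧ 1 ≤ c := by
        rcases hc.eq_or_lt with h | h
        · exact Or.inl h.symm
        · exact Or.inr ⟨s - 1, by omega, by omega⟩
      · refine ⟨T'.length, T' ++ [0], by simp, insertLabel_length_concat _ _, ?_⟩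
        rw [isLatticeWord_concat]
        refine ⟨hT', fun r hr => ?_⟩
        have := hT'.count_succ_le hr
        rw [count_concat, count_concat, if_neg (by omega), if_neg (by omega)]
        exact this
      · have h1 := hs c hc1
        rw [count_concat, count_concat] at h1
        obtain ⟨a, T, ha, hi, hT⟩ := ih hT' hc1 (by split_ifs at h1 <;> omega)
        have haT := (List.getElem?_eq_some_iff.1 ha).1
        have hcount := (hT.insertLabel ha).2
        rw [hi] at hcount
        refine ⟨a, T ++ [c], by rwa [List.getElem?_append_left haT], ?_, ?_⟩
        · rw [insertLabel_concat _ haT, hi]; simp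
        · rw [isLatticeWord_concat]
          refine ⟨hT, fun r hr => ?_⟩
          have e1 := hcount r hr
          have e2 := hcount (r + 1) (by omega)
          have e3 := hT'.count_succ_le hr
          rw [count_concat, count_concat]
          simp only at e1 e2
          split_ifs at * <;> omega
    · have h0 := hlt
      rw [count_concat, count_concat] at h0
      obtain ⟨a, T, ha, hi, hT⟩ := ih hT' hc (by split_ifs at h0 <;> omega)
      have haT := (List.getElem?_eq_some_iff.1 ha).1
      have hcount := (hT.insertLabel ha).2
      rw [hi] at hcount
      refine ⟨a, T ++ [s], by rwa [List.getElem?_append_left haT], ?_, ?_⟩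
      · rw [insertLabel_concat _ haT, hi]; simp [hsc]
      · rw [isLatticeWord_concat]
        refine ⟨hT, fun r hr => ?_⟩
        have e1 := hcount r hr
        have e2 := hcount (r + 1) (by omega)
        have e3 := hs r hr
        have e4 := hT.count_succ_le hr
        rw [count_concat, count_concat] at *
        simp only at e1 e2
        split_ifs at * <;> subst_vars <;> omega

theorem insertLabel_inj {a b : ℕ} {T U : List ℕ} (ha : T[a]? = some 0) (hb : U[b]? = some 0)
    (h : insertLabel (a + 1) T = insertLabel (b + 1) U) : a = b ∧ T = U := by
  induction T using List.reverseRecOn generalizing U a b with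
  | nil => simp at ha
  | append_singleton T s ih =>
    have hlen : U.length = T.length + 1 := by
      have := congrArg (fun q => q.1.length) h
      simpa [length_insertLabel] using this.symm
    obtain ⟨U, u, rfl⟩ : ∃ U' u, U = U' ++ [u] := by
      rcases List.eq_nil_or_concat U with rfl | ⟨U', u, rfl⟩
      · simp at hlen
      · exact ⟨U', u, by simp⟩
    have hl : U.length = T.length := by simpa using hlen
    have ha' := (List.getElem?_eq_some_iff.1 ha).1
    have hb' := (List.getElem?_eq_some_iff.1 hb).1
    simp only [List.length_append, List.length_singleton] at ha' hb'
    rcases (Nat.lt_succ_iff.1 ha').lt_or_eq with ha1 | rfl <;>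
      rcases (Nat.lt_succ_iff.1 hb').lt_or_eq with hb1 | rfl
    · have pa := insertLabel_snd_pos ha1
      have pb := insertLabel_snd_pos hb1
      rw [insertLabel_concat _ ha1, insertLabel_concat _ hb1] at h
      rw [List.getElem?_append_left ha1] at ha
      rw [List.getElem?_append_left hb1] at hb
      have key := ih ha hb
      split_ifs at h with h1 h2 h2 <;>
        simp only [Prod.mk.injEq, List.append_singleton_inj] at h
      · obtain ⟨rfl, rfl⟩ := key (Prod.ext h.1.1 (by omega))
        exact ⟨rfl, by rw [h1, h2]⟩
      · omega
      · omega
      · obtain ⟨rfl, rfl⟩ := key (Prod.ext h.1.1 h.2)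
        exact ⟨rfl, by rw [h.1.2]⟩
    · have pa := insertLabel_snd_pos ha1
      rw [insertLabel_concat _ ha1, insertLabel_length_concat] at h
      split_ifs at h with h1 <;>
        simp only [Prod.mk.injEq, List.append_singleton_inj] at h <;> omega
    · have pb := insertLabel_snd_pos hb1
      rw [insertLabel_concat _ hb1, insertLabel_length_concat] at h
      split_ifs at h with h1 <;>
        simp only [Prod.mk.injEq, List.append_singleton_inj] at h <;> omega
    · rw [insertLabel_length_concat, insertLabel_length_concat] at h
      simp only [Prod.mk.injEq, List.append_singleton_inj] at h
      obtain rfl : s = 0 := by simpa using ha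
      obtain rfl : u = 0 := by simpa using hb
      exact ⟨hl.symm, by rw [h.1.1]⟩

theorem bump_getElem?_eq_zero {c : ℕ} (hc : 1 ≤ c) (S : List ℕ) (i : ℕ) :
    (bump c S).1[i]? = some 0 ↔ S[i]? = some 0 := by
  induction S generalizing c i with
  | nil => simp [bump]
  | cons s S ih =>
    simp only [bump]
    split_ifs with h
    · cases i with
      | zero => simp; omega
      | succ i => simpa using ih (by omega) i
    · cases i with
      | zero => simp
      | succ i => simpa using ih hc i

theorem insertLabel_getElem?_eq_zero {a : ℕ} {T : List ℕ} (ha : a < T.length) (i : ℕ) :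
    (insertLabel (a + 1) T).1[i]? = some 0 ↔ T[i]? = some 0 ∧ i ≠ a := by
  induction T generalizing a i with
  | nil => simp at ha
  | cons t T ih =>
    cases a with
    | zero =>
      cases i with
      | zero => simp [insertLabel]
      | succ i => simpa [insertLabel] using bump_getElem?_eq_zero le_rfl T i
    | succ a =>
      cases i with
      | zero => simp [insertLabel]
      | succ i => simpa [insertLabel] using ih (by simpa using ha) i

theorem exists_drop_bump (c : ℕ) (S : List ℕ) (n : ℕ) :
    ∃ c', c ≤ c' ∧ (bump c S).1.drop n = (bump c' (S.drop n)).1 := by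
  induction n generalizing c S with
  | zero => exact ⟨c, le_rfl, rfl⟩
  | succ n ih =>
    cases S with
    | nil => exact ⟨c, le_rfl, by simp [bump]⟩
    | cons s S =>
      simp only [bump]
      split_ifs
      · obtain ⟨c', h1, h2⟩ := ih (c + 1) S
        exact ⟨c', by omega, by simpa using h2⟩
      · obtain ⟨c', h1, h2⟩ := ih c S
        exact ⟨c', h1, by simpa using h2⟩

theorem drop_insertLabel_of_le {a n : ℕ} (h : n ≤ a) (T : List ℕ) :
    (insertLabel (a + 1) T).1.drop n = (insertLabel (a - n + 1) (T.drop n)).1 := by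
  induction n generalizing a T with
  | zero => simp
  | succ n ih =>
    obtain ⟨a, rfl⟩ : ∃ b, a = b + 1 := ⟨a - 1, by omega⟩
    cases T with
    | nil => simp [insertLabel]
    | cons t T => simpa [insertLabel] using ih (by omega) T

theorem exists_drop_insertLabel_of_lt {a n : ℕ} (h : a < n) (T : List ℕ) :
    ∃ c, 1 ≤ c ∧ (insertLabel (a + 1) T).1.drop n = (bump c (T.drop n)).1 := by
  induction n generalizing a T with
  | zero => omega
  | succ n ih =>
    cases T with
    | nil => exact ⟨1, le_rfl, by simp [insertLabel, bump]⟩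
    | cons t T =>
      cases a with
      | zero => simpa [insertLabel] using exists_drop_bump 1 T n
      | succ a => simpa [insertLabel] using ih (by omega) T

/-- The insertion tableau, with `v` labels, of a word read from right to left. -/
def tableau (v : ℕ) : List ℕ → List ℕ
  | [] => List.replicate v 0
  | a :: w => (insertLabel a (tableau v w)).1

theorem length_tableau (v : ℕ) (w : List ℕ) : (tableau v w).length = v := by
  induction w with
  | nil => simp [tableau]
  | cons a w ih => simp [tableau, length_insertLabel, ih]

theorem isLatticeWord_replicate_zero (v : ℕ) : IsLatticeWord (List.replicate v 0) := by
  intro n r hr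
  have : ∀ m, (List.replicate m 0).count (r + 1) = 0 := fun m => by simp [List.count_replicate]
  simp [List.take_replicate, this]

theorem tableau_getElem?_eq_zero {v : ℕ} {w : List ℕ} (hw : ∀ a ∈ w, 1 ≤ a ∧ a ≤ v) {i : ℕ}
    (hi : i < v) : (tableau v w)[i]? = some 0 ↔ i + 1 ∉ w := by
  induction w with
  | nil => simp [tableau, hi]
  | cons a w ih =>
    obtain ⟨ha1, hav⟩ := hw a (by simp)
    obtain ⟨a, rfl⟩ : ∃ b, a = b + 1 := ⟨a - 1, by omega⟩
    rw [tableau, insertLabel_getElem?_eq_zero (by rw [length_tableau]; omega),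
      ih fun b hb => hw b (by simp [hb])]
    simp only [List.mem_cons, not_or]
    constructor
    · rintro ⟨h1, h2⟩
      exact ⟨by omega, h1⟩
    · rintro ⟨h1, h2⟩
      exact ⟨h2, by omega⟩

theorem isLatticeWord_tableau {v : ℕ} {w : List ℕ} (hw : ∀ a ∈ w, 1 ≤ a ∧ a ≤ v)
    (hn : w.Nodup) : IsLatticeWord (tableau v w) := by
  induction w with
  | nil => exact isLatticeWord_replicate_zero v
  | cons a w ih =>
    obtain ⟨ha1, hav⟩ := hw a (by simp)
    obtain ⟨a, rfl⟩ : ∃ b, a = b + 1 := ⟨a - 1, by omega⟩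
    rw [List.nodup_cons] at hn
    have hw' : ∀ b ∈ w, 1 ≤ b ∧ b ≤ v := fun b hb => hw b (by simp [hb])
    exact ((ih hw' hn.2).insertLabel
      ((tableau_getElem?_eq_zero hw' (by omega)).2 hn.1)).1

/-- Schensted's theorem: the increasing sublists of a word and of its insertion tableau agree. -/
theorem lis_tableau {v : ℕ} {w : List ℕ} (hw : ∀ a ∈ w, 1 ≤ a ∧ a ≤ v) (hn : w.Nodup) (n : ℕ) :
    lis (n + 1) w = lis 1 ((tableau v w).drop n) := by
  induction w generalizing n with
  | nil =>
    have : ∀ m, lis 1 (List.replicate m 0) = 0 := by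
      intro m
      induction m with
      | zero => simp [lis]
      | succ m ih => simp [List.replicate_succ, lis, ih]
    simp [tableau, lis, List.drop_replicate, this]
  | cons a w ih =>
    obtain ⟨ha1, hav⟩ := hw a (by simp)
    obtain ⟨a, rfl⟩ : ∃ b, a = b + 1 := ⟨a - 1, by omega⟩
    rw [List.nodup_cons] at hn
    have hw' : ∀ b ∈ w, 1 ≤ b ∧ b ≤ v := fun b hb => hw b (by simp [hb])
    have ih := ih hw' hn.2
    simp only [lis, tableau]
    split_ifs with h
    · have h : n ≤ a := by omega
      rw [drop_insertLabel_of_le h, (lis_insertLabel _ _ _).1, ih, ih, List.drop_drop]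
      · congr 4; omega
      · rw [List.getElem?_drop, show n + (a - n) = a by omega]
        exact (tableau_getElem?_eq_zero hw' (by omega)).2 hn.1
    · obtain ⟨c, hc, he⟩ := exists_drop_insertLabel_of_lt (show a < n by omega) (tableau v w)
      rw [he, (lis_bump _ _).1 _ hc, ih]

theorem dropLast_tableau {v : ℕ} {w : List ℕ} (hw : ∀ a ∈ w, a ≤ v + 1) :
    (tableau (v + 1) w).dropLast = tableau v (w.filter (· ≤ v)) := by
  induction w with
  | nil => simp [tableau]
  | cons a w ih =>
    have ih := ih fun b hb => hw b (by simp [hb])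
    have ha := hw a (by simp)
    have hlen := length_tableau (v + 1) w
    obtain ⟨U, s, hU⟩ : ∃ U s, tableau (v + 1) w = U ++ [s] := by
      rcases List.eq_nil_or_concat (tableau (v + 1) w) with h | ⟨U, s, h⟩
      · simp [h] at hlen
      · exact ⟨U, s, by simp [h]⟩
    rw [hU] at ih hlen
    have hlen : U.length = v := by simpa using hlen
    simp only [tableau, hU]
    rw [List.dropLast_concat] at ih
    rcases ha.lt_or_eq with h | rfl
    · rw [dropLast_insertLabel_concat _ (by omega), ih, List.filter_cons_of_pos (by simp; omega),
        tableau]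
    · rw [List.filter_cons_of_neg (by simp), ← ih]
      subst hlen
      rw [insertLabel_length_concat, List.dropLast_concat]

theorem lis_eq_zero_or_add_le {k : ℕ} {T : List ℕ} (h : ∀ t ∈ T, t < k) (b : ℕ) :
    lis b T = 0 ∨ lis b T + b ≤ k := by
  induction T generalizing b with
  | nil => simp [lis]
  | cons s T ih =>
    have h' : ∀ t ∈ T, t < k := fun t ht => h t (by simp [ht])
    have := ih h' b
    have := ih h' (s + 1)
    have := h s (by simp)
    simp only [lis]
    split_ifs <;> omega

theorem IsLatticeWord.range'_sublist {T : List ℕ} (hT : IsLatticeWord T) {r : ℕ} (hr : r ∈ T) :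
    (List.range' 1 r).Sublist T := by
  induction T using List.reverseRecOn generalizing r with
  | nil => simp at hr
  | append_singleton T s ih =>
    rw [isLatticeWord_concat] at hT
    obtain ⟨hT, hs⟩ := hT
    rcases List.mem_append.1 hr with h | h
    · exact (ih hT h).trans (List.sublist_append_left _ _)
    · obtain rfl : r = s := by simpa using h
      rcases r with _ | _ | r
      · simp
      · simp
      · have h1 := hs (r + 1) (by omega)
        rw [count_concat, count_concat, if_pos rfl, if_neg (by omega)] at h1
        have h2 : r + 1 ∈ T := List.count_pos_iff.1 (by omega)
        rw [List.range'_concat]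
        refine (ih hT h2).append ?_
        rw [show 1 + 1 * (r + 1) = r + 1 + 1 by omega]

theorem IsLatticeWord.lis_lt_iff {T : List ℕ} (hT : IsLatticeWord T) {k : ℕ} (hk : 1 ≤ k) :
    lis 1 T < k ↔ ∀ t ∈ T, t < k := by
  constructor
  · intro h t ht
    have := length_le_lis (b := 1) (hT.range'_sublist ht)
      (fun s hs => by simp only [List.mem_range'_1] at hs; omega) List.pairwise_lt_range'
    rw [List.length_range'] at this
    omega
  · intro h
    have := lis_eq_zero_or_add_le h 1
    omega

/-- Prepend a letter to a word, the letter `0` meaning that nothing is prepended. -/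
def push (a : ℕ) (w : List ℕ) : List ℕ := if a = 0 then w else a :: w

/-- `x v, …, x 1` are admissible choices of openers (shifted by one, `0` meaning none) for the
closers `v, …, 1`, when `w` is the word of the openers below `v + 1` of the arcs with closer
above `v`. -/
def GoodWord (k : ℕ) : ℕ → List ℕ → (ℕ → ℕ) → Prop
  | 0, _, _ => True
  | v + 1, w, x => (x (v + 1) = 0 ∨ 1 ≤ x (v + 1) ∧ x (v + 1) ≤ v ∧ x (v + 1) ∉ w) ∧
      lis 1 (push (x (v + 1)) w) < k ∧
      GoodWord k v ((push (x (v + 1)) w).filter (· ≤ v)) x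

/-- The analogue of `GoodWord` for tableaux. -/
def GoodTab (k : ℕ) : ℕ → List ℕ → (ℕ → ℕ) → Prop
  | 0, _, _ => True
  | v + 1, T, x => (x (v + 1) = 0 ∨ ∃ a < v, x (v + 1) = a + 1 ∧ T[a]? = some 0) ∧
      (∀ t ∈ (insertLabel (x (v + 1)) T).1, t < k) ∧
      GoodTab k v (insertLabel (x (v + 1)) T).1.dropLast x

theorem tableau_push (v a : ℕ) (w : List ℕ) :
    tableau v (push a w) = (insertLabel a (tableau v w)).1 := by
  unfold push
  split_ifs with h
  · simp [h, insertLabel]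
  · simp [tableau]

theorem goodWord_iff_goodTab {k : ℕ} (hk : 1 ≤ k) {v : ℕ} {w : List ℕ}
    (hw : ∀ a ∈ w, 1 ≤ a ∧ a ≤ v) (hn : w.Nodup) (x : ℕ → ℕ) :
    GoodWord k v w x ↔ GoodTab k v (tableau v w) x := by
  induction v generalizing w with
  | zero => simp [GoodWord, GoodTab]
  | succ v ih =>
    simp only [GoodWord, GoodTab]
    have h1 : (x (v + 1) = 0 ∨ 1 ≤ x (v + 1) ∧ x (v + 1) ≤ v ∧ x (v + 1) ∉ w) ↔
        (x (v + 1) = 0 ∨ ∃ a < v, x (v + 1) = a + 1 ∧ (tableau (v + 1) w)[a]? = some 0) := by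
      refine or_congr_right ⟨?_, ?_⟩
      · rintro ⟨h1, h2, h3⟩
        refine ⟨x (v + 1) - 1, by omega, by omega, ?_⟩
        rw [tableau_getElem?_eq_zero hw (by omega), Nat.sub_add_cancel h1]
        exact h3
      · rintro ⟨a, h1, h2, h3⟩
        rw [tableau_getElem?_eq_zero hw (by omega), ← h2] at h3
        exact ⟨by omega, by omega, h3⟩
    rw [h1]
    refine and_congr_right fun hx => ?_
    rw [← h1] at hx
    have hw' : ∀ a ∈ push (x (v + 1)) w, 1 ≤ a ∧ a ≤ v + 1 := by
      intro a ha
      unfold push at ha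
      split_ifs at ha with h0
      · exact hw a ha
      · rcases List.mem_cons.1 ha with rfl | ha
        · omega
        · exact hw a ha
    have hn' : (push (x (v + 1)) w).Nodup := by
      unfold push
      split_ifs with h0
      · exact hn
      · exact List.nodup_cons.2 ⟨(hx.resolve_left h0).2.2, hn⟩
    rw [← tableau_push, ← (isLatticeWord_tableau hw' hn').lis_lt_iff hk,
      dropLast_tableau fun a ha => (hw' a ha).2]
    rw [← ih (fun a ha => ?_) (hn'.filter _)]
    · have := lis_tableau hw' hn' 0
      rw [List.drop_zero, zero_add] at this
      rw [this]
    · rw [List.mem_filter] at ha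
      exact ⟨(hw' a ha.1).1, by simpa using ha.2⟩

/-- The step vector `e_n`, for any natural number `n`. -/
def stepVec (k n : ℕ) : Pt k := fun j => if (j : ℕ) + 1 = n then 1 else 0

theorem plusStep_iff {k : ℕ} {d : Pt k} : plusStep d ↔ ∃ n < k, d = stepVec k n :=
  ⟨fun ⟨i, h⟩ => ⟨i, i.2, h⟩, fun ⟨n, hn, h⟩ => ⟨⟨n, hn⟩, h⟩⟩

theorem minusStep_iff {k : ℕ} {d : Pt k} : minusStep d ↔ ∃ n < k, d = -stepVec k n :=
  ⟨fun ⟨i, h⟩ => ⟨i, i.2, h⟩, fun ⟨n, hn, h⟩ => ⟨⟨n, hn⟩, h⟩⟩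

theorem stepVec_one (k : ℕ) : stepVec k 1 = eOne k := by
  funext j
  simp [stepVec, eOne]

theorem stepVec_injOn {k m n : ℕ} (hm : m < k) (hn : n < k) (h : stepVec k m = stepVec k n) :
    m = n := by
  by_contra hne
  wlog h1 : 1 ≤ m generalizing m n
  · exact this hn hm h.symm (Ne.symm hne) (by omega)
  have := congrFun h ⟨m - 1, by omega⟩
  simp only [stepVec] at this
  rw [if_pos (by omega), if_neg (by omega)] at this
  omega

/-- `T` is a tableau with `v` labels and at most `k - 1` rows whose shape is `ν - δ`. -/
def IsTab (k v : ℕ) (ν : Pt k) (T : List ℕ) : Prop :=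
  T.length = v ∧ IsLatticeWord T ∧ (∀ t ∈ T, t < k) ∧
    ∀ i : Fin (k - 1), ν i = T.count ((i : ℕ) + 1) + delta k i

/-- The points `ν`, `ν + e_p`, `ν + e_p - e_q` may end, read backwards, a loop-free walk. -/
def Allowed {k : ℕ} (ν : Pt k) (p q : ℕ) : Prop :=
  p < k ∧ q < k ∧ inW ν ∧ inW (ν + stepVec k p) ∧ inW (ν + stepVec k p - stepVec k q) ∧
    ¬(p = 1 ∧ q = 1)

theorem IsLatticeWord.count_add_le {T : List ℕ} (h : IsLatticeWord T) {r : ℕ} (hr : 1 ≤ r)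
    (s : ℕ) : T.count (r + s) ≤ T.count r := by
  induction s with
  | zero => simp
  | succ s ih => exact (h.count_succ_le (r := r + s) (by omega)).trans ih

theorem IsTab.inW {k v : ℕ} {ν : Pt k} {T : List ℕ} (h : IsTab k v ν T) : inW ν := by
  obtain ⟨-, hT, -, hν⟩ := h
  refine ⟨fun i j hij => ?_, fun i => ?_⟩
  · have hij' : (i : ℕ) < j := hij
    have := hT.count_add_le (r := (i : ℕ) + 1) (by omega) (j - i)
    rw [show (i : ℕ) + 1 + (j - i) = j + 1 by omega] at this
    rw [hν, hν]
    simp only [delta]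
    omega
  · rw [hν]
    simp only [delta]
    omega

theorem count_succ_le_of_inW {k : ℕ} {ν : Pt k} {c : ℕ → ℕ} (hc : ∀ r, k ≤ r → c r = 0)
    (hν : ∀ i : Fin (k - 1), ν i = c ((i : ℕ) + 1) + delta k i) (h : inW ν) {r : ℕ}
    (hr : 1 ≤ r) : c (r + 1) ≤ c r := by
  by_cases hk : r + 1 < k
  · have := h.1 (show (⟨r - 1, by omega⟩ : Fin (k - 1)) < ⟨r, by omega⟩ from
      Fin.mk_lt_mk.2 (by omega))
    rw [hν, hν] at this
    simp only [delta, Nat.sub_add_cancel hr] at this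
    omega
  · rw [hc _ (by omega)]
    exact Nat.zero_le _

theorem goodTab_congr {k v : ℕ} {T : List ℕ} {x y : ℕ → ℕ} (h : ∀ j, 1 ≤ j → j ≤ v → x j = y j) :
    GoodTab k v T x ↔ GoodTab k v T y := by
  induction v generalizing T with
  | zero => simp [GoodTab]
  | succ v ih =>
    simp only [GoodTab, h (v + 1) (by omega) le_rfl]
    rw [ih fun j h1 h2 => h j h1 (by omega)]

/-- Pairs of a tableau of shape `ν - δ` with labels `1, …, v` and a sequence of admissible
choices emptying it. -/
abbrev TabPair (k v : ℕ) (ν : Pt k) : Type :=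
  {y : List ℕ × (ℕ → ℕ) //
    IsTab k v ν y.1 ∧ GoodTab k v y.1 y.2 ∧ ∀ j, j = 0 ∨ v < j → y.2 j = 0}

/-- Loop-free walks from `δ` to `ν`. -/
abbrev WalkTo (k m : ℕ) (ν : Pt k) : Type :=
  {v : Fin (2 * m + 1) → Pt k //
    IsBWalk (inW (k := k)) (2 * m) v ∧ LoopFree v ∧ v (Fin.last (2 * m)) = ν}

theorem insertLabel_spec {T : List ℕ} (hT : IsLatticeWord T) {a : ℕ}
    (ha : a = 0 ∨ ∃ b, a = b + 1 ∧ T[b]? = some 0) :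
    IsLatticeWord (insertLabel a T).1 ∧ ((insertLabel a T).2 = 0 ↔ a = 0) ∧
    ∀ r, 1 ≤ r → (insertLabel a T).1.count r =
      T.count r + if r = (insertLabel a T).2 then 1 else 0 := by
  rcases ha with rfl | ⟨b, rfl, hb⟩
  · refine ⟨hT, iff_of_true rfl rfl, fun r hr => ?_⟩
    simp [insertLabel, Nat.one_le_iff_ne_zero.1 hr]
  · obtain ⟨h1, h2⟩ := hT.insertLabel hb
    have := insertLabel_snd_pos (List.getElem?_eq_some_iff.1 hb).1
    exact ⟨h1, by omega, h2⟩

theorem tabPair_sigma_ext {k v : ℕ} {ν : Pt k}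
    {s t : Σ pq : {pq : ℕ × ℕ // Allowed ν pq.1 pq.2},
      TabPair k v (ν + stepVec k pq.1.1 - stepVec k pq.1.2)}
    (h1 : s.1.1 = t.1.1) (h2 : s.2.1 = t.2.1) : s = t := by
  obtain ⟨⟨i, hi⟩, ⟨a, ha⟩⟩ := s
  obtain ⟨⟨j, hj⟩, ⟨b, hb⟩⟩ := t
  obtain rfl : i = j := h1
  obtain rfl : a = b := h2
  rfl

theorem walkTo_sigma_ext {k m : ℕ} {ν : Pt k}
    {s t : Σ pq : {pq : ℕ × ℕ // Allowed ν pq.1 pq.2},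
      WalkTo k m (ν + stepVec k pq.1.1 - stepVec k pq.1.2)}
    (h1 : s.1.1 = t.1.1) (h2 : s.2.1 = t.2.1) : s = t := by
  obtain ⟨⟨i, hi⟩, ⟨a, ha⟩⟩ := s
  obtain ⟨⟨j, hj⟩, ⟨b, hb⟩⟩ := t
  obtain rfl : i = j := h1
  obtain rfl : a = b := h2
  rfl

theorem IsTab.insertLabel {k v : ℕ} {ν : Pt k} {T : List ℕ} (h : IsTab k (v + 1) ν T) {a : ℕ}
    (ha : a = 0 ∨ ∃ b < v, a = b + 1 ∧ T[b]? = some 0)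
    (hk : 1 ≤ k) (ht : ∀ t ∈ (insertLabel a T).1, t < k) :
    ∃ U q, (BraidWalk.insertLabel a T).1 = U ++ [q] ∧
      Allowed ν (BraidWalk.insertLabel a T).2 q ∧
      IsTab k v (ν + stepVec k (BraidWalk.insertLabel a T).2 - stepVec k q) U := by
  obtain ⟨hlen, hT, htk, hν⟩ := h
  obtain ⟨h1, h2, h3⟩ := insertLabel_spec hT (ha.imp_right fun ⟨b, _, hb⟩ => ⟨b, hb⟩)
  have hl := length_insertLabel a T
  obtain ⟨U, q, hU⟩ : ∃ U q, (BraidWalk.insertLabel a T).1 = U ++ [q] := by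
    rcases List.eq_nil_or_concat (BraidWalk.insertLabel a T).1 with h | ⟨U, s, h⟩
    · simp [h] at hl; omega
    · exact ⟨U, s, by simp [h]⟩
  have hpq : ¬((BraidWalk.insertLabel a T).2 = 1 ∧ q = 1) := by
    rintro ⟨hc, rfl⟩
    rcases ha with rfl | ⟨b, hb, rfl, -⟩
    · simp [BraidWalk.insertLabel] at hc
    · obtain ⟨V, s, rfl⟩ : ∃ V s, T = V ++ [s] := by
        rcases List.eq_nil_or_concat T with h | ⟨V, s, h⟩
        · simp [h] at hlen
        · exact ⟨V, s, by simp [h]⟩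
      have hbV : b < V.length := by simp at hlen; omega
      have := insertLabel_snd_pos hbV
      rw [insertLabel_concat _ hbV] at hU hc
      split_ifs at hU hc
      · simp only at hc; omega
      · simp only [List.append_singleton_inj] at hU hc; omega
  generalize (BraidWalk.insertLabel a T).2 = c at *
  rw [hU] at h1 h3 ht hl
  have hc : c < k := by
    rcases Nat.eq_zero_or_pos c with rfl | hc
    · omega
    · have := h3 c hc
      rw [if_pos rfl] at this
      exact ht c (List.count_pos_iff.1 (by omega))
  have hq : q < k := ht q (by simp)
  have hT' : IsTab k (v + 1) (ν + stepVec k c) (U ++ [q]) := by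
    refine ⟨by omega, h1, ht, fun i => ?_⟩
    rw [h3 _ (by omega), Pi.add_apply, hν]
    simp only [stepVec]
    split_ifs <;> push_cast <;> ring
  have hU' : IsTab k v (ν + stepVec k c - stepVec k q) U := by
    refine ⟨by simp at hl; omega, (isLatticeWord_concat.1 h1).1,
      fun t h => ht t (by simp [h]), fun i => ?_⟩
    rw [Pi.sub_apply, hT'.2.2.2 i, count_concat]
    simp only [stepVec]
    by_cases h : q = (i : ℕ) + 1
    · rw [if_pos h, if_pos h.symm]; push_cast; ring
    · rw [if_neg h, if_neg (Ne.symm h)]; push_cast; ring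
  exact ⟨U, q, hU, ⟨hc, hq, IsTab.inW (v := v + 1) ⟨hlen, hT, htk, hν⟩, hT'.inW, hU'.inW, hpq⟩,
    hU'⟩

theorem exists_insertLabel_of_allowed {k v : ℕ} {ν : Pt k} {p q : ℕ} (h : Allowed ν p q)
    {U : List ℕ} (hU : IsTab k v (ν + stepVec k p - stepVec k q) U) :
    ∃ a T, (a = 0 ∨ ∃ b < v, a = b + 1 ∧ T[b]? = some 0) ∧ IsTab k (v + 1) ν T ∧
      insertLabel a T = (U ++ [q], p) := by
  obtain ⟨hp, hq, hν, hνp, -, hpq⟩ := h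
  obtain ⟨hlen, hUl, hUk, hUν⟩ := hU
  have hk' : ∀ t ∈ U ++ [q], t < k := by
    intro t ht
    rcases List.mem_append.1 ht with ht | ht
    · exact hUk t ht
    · obtain rfl : t = q := by simpa using ht
      exact hq
  have hzero : ∀ r, k ≤ r → (U ++ [q]).count r = 0 := fun r hr =>
    List.count_eq_zero.2 fun h => absurd (hk' r h) (by omega)
  have hcount : ∀ i : Fin (k - 1),
      (ν + stepVec k p) i = (U ++ [q]).count ((i : ℕ) + 1) + delta k i := by
    intro i
    have := hUν i
    rw [Pi.sub_apply] at this
    rw [count_concat, sub_eq_iff_eq_add.1 this]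
    simp only [stepVec]
    by_cases h : q = (i : ℕ) + 1
    · rw [if_pos h, if_pos h.symm]; push_cast; ring
    · rw [if_neg h, if_neg (Ne.symm h)]; push_cast; ring
  have hlat : IsLatticeWord (U ++ [q]) := isLatticeWord_concat.2 ⟨hUl, fun r hr =>
    count_succ_le_of_inW (c := fun r => (U ++ [q]).count r) hzero hcount hνp hr⟩
  have hν' : ∀ i : Fin (k - 1), ν i =
      (U ++ [q]).count ((i : ℕ) + 1) + delta k i - if (i : ℕ) + 1 = p then 1 else 0 := by
    intro i
    rw [← hcount i, Pi.add_apply]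
    simp only [stepVec]
    ring
  rcases Nat.eq_zero_or_pos p with rfl | hp1
  · refine ⟨0, U ++ [q], Or.inl rfl, ⟨by simp [hlen], hlat, hk', fun i => ?_⟩, rfl⟩
    rw [hν' i, if_neg (by omega), sub_zero]
  · have hlt : (U ++ [q]).count (p + 1) < (U ++ [q]).count p := by
      by_cases hpk : p + 1 < k
      · have := hν.1 (show (⟨p - 1, by omega⟩ : Fin (k - 1)) < ⟨p, by omega⟩ from
          Fin.mk_lt_mk.2 (by omega))
        rw [hν', hν'] at this
        simp only [delta, Nat.sub_add_cancel hp1] at this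
        rw [if_neg (by omega)] at this
        simp only [if_true] at this
        omega
      · have := hν.2 ⟨p - 1, by omega⟩
        rw [hν'] at this
        simp only [delta, Nat.sub_add_cancel hp1, if_true] at this
        rw [hzero (p + 1) (by omega)]
        omega
    obtain ⟨a, T, ha, hi, hT⟩ := exists_insertLabel_eq hlat hp1 hlt
    have haT := (List.getElem?_eq_some_iff.1 ha).1
    have hlenT : T.length = v + 1 := by
      have := length_insertLabel (a + 1) T
      rw [hi] at this
      simpa [hlen] using this.symm
    have hc := (hT.insertLabel ha).2
    rw [hi] at hc
    simp only at hc
    refine ⟨a + 1, T, Or.inr ⟨a, ?_, rfl, ha⟩, ⟨hlenT, hT, fun t ht => ?_, fun i => ?_⟩, hi⟩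
    · by_contra hav
      obtain ⟨V, s, rfl⟩ : ∃ V s, T = V ++ [s] := by
        rcases List.eq_nil_or_concat T with h | ⟨V, s, h⟩
        · simp [h] at hlenT
        · exact ⟨V, s, by simp [h]⟩
      obtain rfl : a = V.length := by simp at hlenT haT; omega
      rw [insertLabel_length_concat] at hi
      simp only [Prod.mk.injEq, List.append_singleton_inj] at hi
      exact hpq ⟨hi.2.symm, hi.1.2.symm⟩
    · rcases Nat.eq_zero_or_pos t with rfl | ht1
      · omega
      · have := hc t ht1
        have h2 := List.count_pos_iff.2 ht
        exact hk' t (List.count_pos_iff.1 (by omega))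
    · rw [hν' i, hc _ (by omega)]
      split_ifs <;> push_cast <;> ring

theorem nonempty_tabPair_equiv_sigma {k : ℕ} (hk : 1 ≤ k) (v : ℕ) (ν : Pt k) :
    Nonempty (TabPair k (v + 1) ν ≃
      Σ pq : {pq : ℕ × ℕ // Allowed ν pq.1 pq.2},
        TabPair k v (ν + stepVec k pq.1.1 - stepVec k pq.1.2)) := by
  have key : ∀ y : TabPair k (v + 1) ν, ∃ s : Σ pq : {pq : ℕ × ℕ // Allowed ν pq.1 pq.2},
      TabPair k v (ν + stepVec k pq.1.1 - stepVec k pq.1.2),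
      insertLabel (y.1.2 (v + 1)) y.1.1 = (s.2.1.1 ++ [s.1.1.2], s.1.1.1) ∧
      s.2.1.2 = Function.update y.1.2 (v + 1) 0 := by
    rintro ⟨⟨T, x⟩, hT, ⟨h1, h2, h3⟩, hx⟩
    obtain ⟨U, q, e, hA, hU⟩ := hT.insertLabel h1 hk h2
    refine ⟨⟨⟨(_, q), hA⟩, ⟨(U, Function.update x (v + 1) 0), hU, ?_, ?_⟩⟩, ?_, rfl⟩
    · simp only at h3
      rw [e, List.dropLast_concat] at h3
      refine (goodTab_congr fun j hj1 hj2 => ?_).1 h3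
      exact (Function.update_of_ne (by omega) _ _).symm
    · intro j hj
      by_cases hjv : j = v + 1
      · simp [hjv]
      · simp only at hx ⊢
        rw [Function.update_of_ne hjv]
        exact hx j (by omega)
    · exact Prod.ext e rfl
  choose f hf1 hf2 using key
  refine ⟨Equiv.ofBijective f ⟨fun y y' h => ?_, fun s => ?_⟩⟩
  · have e1 := hf1 y
    have e2 := hf2 y
    rw [h] at e1 e2
    have e1' := e1.trans (hf1 y').symm
    have e2' := e2.symm.trans (hf2 y')
    obtain ⟨⟨T, x⟩, hT, ⟨h1, _⟩, _⟩ := y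
    obtain ⟨⟨T', x'⟩, hT', ⟨h1', _⟩, _⟩ := y'
    change insertLabel (x (v + 1)) T = insertLabel (x' (v + 1)) T' at e1'
    change Function.update x (v + 1) 0 = Function.update x' (v + 1) 0 at e2'
    simp only at h1 h1' hT hT'
    have hxT : x (v + 1) = x' (v + 1) ∧ T = T' := by
      have g := (insertLabel_spec hT.2.1 (h1.imp_right fun ⟨b, _, hb⟩ => ⟨b, hb⟩)).2.1
      have g' := (insertLabel_spec hT'.2.1 (h1'.imp_right fun ⟨b, _, hb⟩ => ⟨b, hb⟩)).2.1
      rw [e1', g'] at g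
      rcases h1 with h1 | ⟨b, -, hb, hbT⟩
      · have h1' := g.2 h1
        rw [h1, h1'] at e1'
        exact ⟨h1.trans h1'.symm, congrArg Prod.fst e1'⟩
      · rcases h1' with h1' | ⟨b', -, hb', hbT'⟩
        · have := g.1 h1'
          omega
        · rw [hb, hb'] at e1'
          obtain ⟨rfl, rfl⟩ := insertLabel_inj hbT hbT' e1'
          exact ⟨hb.trans hb'.symm, rfl⟩
    have hxx : x = x' := by
      funext j
      by_cases hj : j = v + 1
      · rw [hj, hxT.1]
      · have := congrFun e2' j
        rwa [Function.update_of_ne hj, Function.update_of_ne hj] at this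
    obtain rfl := hxT.2
    subst hxx
    rfl
  · obtain ⟨⟨⟨p, q⟩, hA⟩, ⟨⟨U, x⟩, hU, hG, hx⟩⟩ := s
    simp only at hA hU hG hx
    obtain ⟨a, T, ha, hT, hi⟩ := exists_insertLabel_of_allowed hA hU
    have hG' : GoodTab k (v + 1) T (Function.update x (v + 1) a) := by
      simp only [GoodTab, Function.update_self, hi, List.dropLast_concat]
      refine ⟨ha, fun t ht => ?_, (goodTab_congr fun j hj1 hj2 => ?_).1 hG⟩
      · rcases List.mem_append.1 ht with ht | ht
        · exact hU.2.2.1 t ht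
        · obtain rfl : t = q := by simpa using ht
          exact hA.2.1
      · rw [Function.update_of_ne (by omega)]
    refine ⟨⟨(T, Function.update x (v + 1) a), hT, hG', fun j hj => ?_⟩, ?_⟩
    · simp only
      rw [Function.update_of_ne (by omega)]
      exact hx j (by omega)
    · have e1 := hf1 ⟨(T, Function.update x (v + 1) a), hT, hG', fun j hj => by
        simp only
        rw [Function.update_of_ne (by omega)]
        exact hx j (by omega)⟩
      have e2 := hf2 ⟨(T, Function.update x (v + 1) a), hT, hG', fun j hj => by
        simp only
        rw [Function.update_of_ne (by omega)]
        exact hx j (by omega)⟩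
      simp only [Function.update_self, hi, Prod.mk.injEq, List.append_singleton_inj] at e1 e2
      refine tabPair_sigma_ext ?_ ?_
      · exact Prod.ext e1.2.symm e1.1.2.symm
      refine Prod.ext ?_ ?_
      · exact e1.1.1.symm
      rw [e2, Function.update_idem, Function.update_eq_self_iff]
      exact (hx (v + 1) (by omega)).symm

theorem nonempty_walkTo_equiv_sigma {k : ℕ} (hk : 2 ≤ k) (m : ℕ) (ν : Pt k) :
    Nonempty ((Σ pq : {pq : ℕ × ℕ // Allowed ν pq.1 pq.2},
        WalkTo k m (ν + stepVec k pq.1.1 - stepVec k pq.1.2)) ≃ WalkTo k (m + 1) ν) := by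
  have key : ∀ s : Σ pq : {pq : ℕ × ℕ // Allowed ν pq.1 pq.2},
      WalkTo k m (ν + stepVec k pq.1.1 - stepVec k pq.1.2), ∃ u : WalkTo k (m + 1) ν,
      (∀ t (h : t < 2 * m + 1), u.1 ⟨t, by omega⟩ = s.2.1 ⟨t, h⟩) ∧
      u.1 ⟨2 * m + 1, by omega⟩ = ν + stepVec k s.1.1.1 := by
    rintro ⟨⟨⟨p, q⟩, hp, hq, hν, hνp, -, hpq⟩, ⟨w, ⟨hw0, hwW, hws⟩, hwl, hwe⟩⟩
    simp only at hp hq hν hνp hpq hwe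
    let u : Fin (2 * (m + 1) + 1) → Pt k := fun t =>
      if h : (t : ℕ) < 2 * m + 1 then w ⟨t, h⟩
      else if (t : ℕ) = 2 * m + 1 then ν + stepVec k p else ν
    have hu1 : ∀ t (h : t < 2 * m + 1), u ⟨t, by omega⟩ = w ⟨t, h⟩ := fun t h => by
      simp only [u, h, dif_pos]
    have hu2 : u ⟨2 * m + 1, by omega⟩ = ν + stepVec k p := by simp [u]
    have hu3 : u ⟨2 * m + 2, by omega⟩ = ν := by simp [u]
    have hu0 : u ⟨2 * m, by omega⟩ = ν + stepVec k p - stepVec k q := by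
      rw [hu1 _ (by omega), ← hwe]; rfl
    refine ⟨⟨u, ⟨?_, ?_, ?_⟩, ?_, ?_⟩, hu1, hu2⟩
    · rw [hu1 _ (by omega), hw0]
    · intro t
      simp only [u]
      split_ifs
      · exact hwW _
      · exact hνp
      · exact hν
    · intro t h
      obtain h' | rfl | rfl : t < 2 * m ∨ t = 2 * m ∨ t = 2 * m + 1 := by omega
      · rw [hu1 _ (by omega), hu1 _ (by omega)]
        exact hws t (by omega)
      · refine ⟨fun _ => plusStep_iff.2 ⟨q, hq, ?_⟩, fun he => ?_⟩
        · rw [hu2, hu0]; abel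
        · exact absurd he (by rw [Nat.not_even_iff_odd]; exact ⟨m, rfl⟩)
      · refine ⟨fun ho => ?_, fun _ => minusStep_iff.2 ⟨p, hp, ?_⟩⟩
        · exact absurd ho (by rw [Nat.not_odd_iff_even]; exact ⟨m + 1, by ring⟩)
        · rw [hu2, hu3]; abel
    · intro r hr h
      rcases lt_or_ge (2 * r) (2 * m + 1) with h' | h'
      · rw [hu1 _ (by omega), hu1 _ (by omega), hu1 _ h']
        exact hwl r hr h'
      · obtain rfl : r = m + 1 := by omega
        rintro ⟨h1, h2⟩
        have h1' : u ⟨2 * m + 1, by omega⟩ - u ⟨2 * m, by omega⟩ = eOne k := h1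
        have h2' : u ⟨2 * m + 2, by omega⟩ - u ⟨2 * m + 1, by omega⟩ = -eOne k := h2
        rw [hu2, hu0, ← stepVec_one, sub_sub_cancel] at h1'
        rw [hu2, hu3, ← stepVec_one, sub_add_cancel_left, neg_inj] at h2'
        exact hpq ⟨stepVec_injOn hp (by omega) h2', stepVec_injOn hq (by omega) h1'⟩
    · exact hu3
  choose f hf1 hf2 using key
  refine ⟨Equiv.ofBijective f ⟨fun s s' h => ?_, fun u => ?_⟩⟩
  · have e1 := hf1 s
    have e2 := hf2 s
    rw [h] at e1 e2
    have e1' : ∀ t (h : t < 2 * m + 1), s.2.1 ⟨t, h⟩ = s'.2.1 ⟨t, h⟩ :=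
      fun t h => (e1 t h).symm.trans (hf1 s' t h)
    have e2' := e2.symm.trans (hf2 s')
    have hp := stepVec_injOn s.1.2.1 s'.1.2.1 (add_left_cancel e2')
    have hl : s.2.1 (Fin.last _) = s'.2.1 (Fin.last _) := e1' (2 * m) (by omega)
    rw [s.2.2.2.2, s'.2.2.2.2, e2'] at hl
    have hq := stepVec_injOn s.1.2.2.1 s'.1.2.2.1 (sub_right_injective hl)
    exact walkTo_sigma_ext (Prod.ext hp hq) (funext fun t : Fin _ => e1' t.1 t.2)
  · obtain ⟨u, ⟨hu0, huW, hus⟩, hul, hue⟩ := u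
    have hue' : u ⟨2 * m + 2, by omega⟩ = ν := hue
    obtain ⟨q, hq, hq'⟩ := plusStep_iff.1 ((hus (2 * m) (by omega)).1 ⟨m, rfl⟩)
    obtain ⟨p, hp, hp'⟩ := minusStep_iff.1 ((hus (2 * m + 1) (by omega)).2 ⟨m + 1, by ring⟩)
    have e1 : u ⟨2 * m + 1, by omega⟩ = ν + stepVec k p := by
      rw [← hue']
      rw [sub_eq_iff_eq_add] at hp'
      rw [hp']; abel
    have e0 : u ⟨2 * m, by omega⟩ = ν + stepVec k p - stepVec k q := by
      rw [← e1, ← hq']; abel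
    have hA : Allowed ν p q := by
      refine ⟨hp, hq, hue' ▸ huW _, e1 ▸ huW _, e0 ▸ huW _, ?_⟩
      rintro ⟨rfl, rfl⟩
      rw [stepVec_one] at hq' hp'
      exact hul (m + 1) (by omega) (by omega) ⟨hq', hp'⟩
    let w : Fin (2 * m + 1) → Pt k := fun t => u ⟨t, by omega⟩
    have hw : IsBWalk (inW (k := k)) (2 * m) w ∧ LoopFree w ∧
        w (Fin.last (2 * m)) = ν + stepVec k p - stepVec k q :=
      ⟨⟨hu0, fun t => huW _, fun t h => hus t (by omega)⟩,
        fun r hr h => hul r hr (by omega), e0⟩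
    refine ⟨⟨⟨(p, q), hA⟩, ⟨w, hw⟩⟩, Subtype.ext (funext fun t => ?_)⟩
    obtain ⟨t, ht⟩ := t
    obtain h | rfl | rfl : t < 2 * m + 1 ∨ t = 2 * m + 1 ∨ t = 2 * m + 2 := by omega
    · exact hf1 ⟨⟨(p, q), hA⟩, ⟨w, hw⟩⟩ t h
    · exact (hf2 ⟨⟨(p, q), hA⟩, ⟨w, hw⟩⟩).trans e1.symm
    · exact (f ⟨⟨(p, q), hA⟩, ⟨w, hw⟩⟩).2.2.2.trans hue'.symm

theorem nonempty_tabPair_equiv_walkTo {k : ℕ} (hk : 2 ≤ k) (m : ℕ) (ν : Pt k) :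
    Nonempty (TabPair k m ν ≃ WalkTo k m ν) := by
  induction m generalizing ν with
  | zero =>
    have hδ : IsTab k 0 (delta k) [] := ⟨rfl, fun n r _ => by simp, by simp, by simp⟩
    have h1 : Subsingleton (TabPair k 0 ν) := by
      refine ⟨?_⟩
      rintro ⟨⟨T, x⟩, hT, -, hx⟩ ⟨⟨T', x'⟩, hT', -, hx'⟩
      obtain rfl := List.length_eq_zero_iff.1 hT.1
      obtain rfl := List.length_eq_zero_iff.1 hT'.1
      obtain rfl : x = x' :=
        funext fun j => (hx j (by omega)).trans (hx' j (by omega)).symm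
      rfl
    have h2 : Subsingleton (WalkTo k 0 ν) := by
      refine ⟨?_⟩
      rintro ⟨u, hu, -⟩ ⟨u', hu', -⟩
      obtain rfl : u = u' := by
        funext t
        obtain rfl : t = ⟨0, by omega⟩ := Fin.ext (by omega)
        exact hu.1.trans hu'.1.symm
      rfl
    refine ⟨Equiv.ofBijective (fun y => ⟨fun _ => ν, ?_⟩) ⟨fun _ _ _ => Subsingleton.elim _ _,
      fun u => ⟨⟨([], fun _ => 0), ?_, trivial, fun _ _ => rfl⟩, Subsingleton.elim _ _⟩⟩⟩
    · have hν : ν = delta k := by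
        funext i
        rw [y.2.1.2.2.2 i, List.length_eq_zero_iff.1 y.2.1.1]
        simp
      exact ⟨⟨hν, fun _ => y.2.1.inW, fun t h => by omega⟩, fun r hr h => by omega, rfl⟩
    · have : ν = delta k := u.2.2.2.symm.trans u.2.1.1
      rw [this]
      exact hδ
  | succ m ih =>
    obtain ⟨e1⟩ := nonempty_tabPair_equiv_sigma (by omega : 1 ≤ k) m ν
    obtain ⟨e2⟩ := nonempty_walkTo_equiv_sigma hk m ν
    exact ⟨e1.trans ((Equiv.sigmaCongrRight fun pq => (ih _).some).trans e2)⟩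

theorem le_lis_filter_map_range'_iff {k s n : ℕ} {x : ℕ → ℕ} {p : ℕ → Bool}
    (hp : ∀ a, p a → 1 ≤ a) :
    k ≤ lis 1 (((List.range' s n).map x).filter p) ↔
      ∃ jj : Fin k → ℕ, StrictMono jj ∧ StrictMono (x ∘ jj) ∧
        ∀ m, s ≤ jj m ∧ jj m < s + n ∧ p (x (jj m)) := by
  rw [List.filter_map]
  constructor
  · intro h
    obtain ⟨l, hl, -, hlt, hlen⟩ := exists_sublist_of_le_lis _ _ _ h
    obtain ⟨l', hl', rfl⟩ := List.sublist_map_iff.1 hl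
    have hs : l'.Pairwise (· < ·) :=
      List.Pairwise.sublist (hl'.trans List.filter_sublist) List.pairwise_lt_range'
    rw [List.pairwise_map] at hlt
    rw [List.length_map] at hlen
    refine ⟨fun m => l'[m], fun a b hab => ?_, fun a b hab => ?_, fun m => ?_⟩
    · exact List.pairwise_iff_getElem.1 hs _ _ _ _ hab
    · exact List.pairwise_iff_getElem.1 hlt _ _ _ _ hab
    · have := hl'.subset (List.getElem_mem (l := l') (n := m) (by omega))
      simp only [List.mem_filter, List.mem_range'_1, Function.comp_apply] at this
      exact ⟨this.1.1, this.1.2, this.2⟩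
  · rintro ⟨jj, h1, h2, h3⟩
    have hs : (List.ofFn jj).Pairwise (· < ·) := List.pairwise_ofFn.2 fun _ _ h => h1 h
    have hsub : (List.ofFn jj).Sublist ((List.range' s n).filter (p ∘ x)) := by
      refine List.sublist_of_subperm_of_pairwise
        (List.subperm_of_subset (hs.imp fun h => h.ne) fun a ha => ?_) hs
        (List.Pairwise.filter _ List.pairwise_lt_range')
      obtain ⟨m, rfl⟩ := (List.mem_ofFn' _ _).1 ha
      simp only [List.mem_filter, List.mem_range'_1, Function.comp_apply]
      exact ⟨⟨(h3 m).1, (h3 m).2.1⟩, (h3 m).2.2⟩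
    have := length_le_lis (b := 1) (hsub.map x) (fun t ht => ?_) ?_
    · simpa using this
    · obtain ⟨j, hj, rfl⟩ := List.mem_map.1 ht
      obtain ⟨m, rfl⟩ := (List.mem_ofFn' _ _).1 hj
      exact hp _ (h3 m).2.2
    · rw [List.map_ofFn]
      exact List.pairwise_ofFn.2 fun _ _ h => h2 h

/-- `x` encodes the arcs of a `2`-regular `k`-noncrossing partition of `{0, …, M}`: `x j = i + 1`
if `(i, j)` is an arc and `x j = 0` if no arc ends in `j`. -/
def ArcCode (k M : ℕ) (x : ℕ → ℕ) : Prop :=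
  (∀ j, j = 0 ∨ M < j → x j = 0) ∧ (∀ j, x j ≠ 0 → x j < j) ∧
    (∀ i j, x i = x j → x i ≠ 0 → i = j) ∧
    ¬∃ jj : Fin k → ℕ, StrictMono jj ∧ StrictMono (x ∘ jj) ∧
      ∀ m m', 0 < x (jj m) ∧ x (jj m) ≤ jj m'

/-- The word of the openers up to `v` of the arcs with closer above `v`. -/
def window (M : ℕ) (x : ℕ → ℕ) (v : ℕ) : List ℕ :=
  ((List.range' (v + 1) (M - v)).map x).filter fun a => 1 ≤ a ∧ a ≤ v

theorem push_window {M v : ℕ} {x : ℕ → ℕ} (hv : v < M) (h : x (v + 1) ≤ v + 1) :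
    push (x (v + 1)) (window M x (v + 1)) =
      ((List.range' (v + 1) (M - v)).map x).filter fun a => 1 ≤ a ∧ a ≤ v + 1 := by
  rw [show M - v = (M - (v + 1)) + 1 by omega, List.range'_succ, List.map_cons, List.filter_cons]
  unfold push window
  by_cases h0 : x (v + 1) = 0
  · simp [h0]
  · rw [if_neg h0, if_pos (by simp; omega)]

theorem filter_push_window {M v : ℕ} {x : ℕ → ℕ} (hv : v < M) (h : x (v + 1) ≤ v + 1) :
    (push (x (v + 1)) (window M x (v + 1))).filter (· ≤ v) = window M x v := by
  rw [push_window hv h, window, List.filter_filter]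
  congr 1
  funext a
  rw [Bool.eq_iff_iff]
  simp
  omega

theorem goodWord_window_iff {k M : ℕ} {x : ℕ → ℕ} {v : ℕ} (hv : v ≤ M) :
    GoodWord k v (window M x v) x ↔ ∀ u < v,
      (x (u + 1) = 0 ∨ 1 ≤ x (u + 1) ∧ x (u + 1) ≤ u ∧ x (u + 1) ∉ window M x (u + 1)) ∧
      lis 1 (((List.range' (u + 1) (M - u)).map x).filter fun a => 1 ≤ a ∧ a ≤ u + 1) < k := by
  induction v with
  | zero => simp [GoodWord]
  | succ v ih =>
    rw [Nat.forall_lt_succ_right, ← ih (by omega), and_comm, GoodWord, ← and_assoc]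
    by_cases h : x (v + 1) ≤ v
    · rw [filter_push_window hv (by omega), push_window hv (by omega)]
    · refine iff_of_false (fun h' => ?_) (fun h' => ?_) <;> omega

theorem arcCode_iff {k M : ℕ} (hk : 1 ≤ k) {x : ℕ → ℕ} :
    ArcCode k M x ↔ GoodWord k M [] x ∧ ∀ j, j = 0 ∨ M < j → x j = 0 := by
  have hw : window M x M = [] := by simp [window]
  rw [← hw, goodWord_window_iff le_rfl, ArcCode]
  constructor
  · rintro ⟨h1, h2, h3, h4⟩
    refine ⟨fun u hu => ⟨?_, ?_⟩, h1⟩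
    · refine or_iff_not_imp_left.2 fun h0 => ⟨by omega, Nat.le_of_lt_succ (h2 _ h0), fun hm => ?_⟩
      simp only [window, List.mem_filter, List.mem_map, List.mem_range'_1] at hm
      obtain ⟨⟨j, hj, hx⟩, -⟩ := hm
      have := h3 _ _ hx (by omega)
      omega
    · by_contra hl
      rw [not_lt, le_lis_filter_map_range'_iff (by simp +contextual)] at hl
      obtain ⟨jj, hj, hx, hb⟩ := hl
      refine h4 ⟨jj, hj, hx, fun m m' => ?_⟩
      have hm := (hb m).2.2
      have hm' := (hb m').1
      simp only [decide_eq_true_eq] at hm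
      omega
  · rintro ⟨hG, h1⟩
    have hlt : ∀ j, x j ≠ 0 → 1 ≤ j ∧ j ≤ M := fun j hj => by
      by_contra h
      exact hj (h1 j (by omega))
    have h2 : ∀ j, x j ≠ 0 → x j < j := by
      intro j hj
      obtain ⟨u, rfl⟩ : ∃ u, j = u + 1 := ⟨j - 1, by have := hlt j hj; omega⟩
      have := (hG u (by have := hlt _ hj; omega)).1
      omega
    refine ⟨h1, h2, ?_, ?_⟩
    · intro i j hij hi
      by_contra hne
      wlog h : i < j generalizing i j
      · exact this j i hij.symm (hij ▸ hi) (Ne.symm hne) (by omega)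
      obtain ⟨u, rfl⟩ : ∃ u, i = u + 1 := ⟨i - 1, by have := hlt i hi; omega⟩
      have hj := hlt j (hij ▸ hi)
      have hu := h2 _ hi
      refine ((hG u (by omega)).1.resolve_left hi).2.2 ?_
      simp only [window, List.mem_filter, List.mem_map, List.mem_range'_1, decide_eq_true_eq]
      exact ⟨⟨j, by omega, hij.symm⟩, by omega, by omega⟩
    · rintro ⟨jj, hj, hx, hb⟩
      let z : Fin k := ⟨0, hk⟩
      have hz := hlt (jj z) (hb z z).1.ne'
      obtain ⟨u, hu⟩ : ∃ u, jj z = u + 1 := ⟨jj z - 1, by omega⟩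
      refine (hG u (by omega)).2.not_ge ((le_lis_filter_map_range'_iff (by simp +contextual)).2
        ⟨jj, hj, hx, fun m => ?_⟩)
      have h0 : jj z ≤ jj m := hj.monotone (Fin.mk_le_of_le_val (Nat.zero_le _))
      have hm := hlt (jj m) (hb m m).1.ne'
      have := hb m z
      refine ⟨by omega, by omega, ?_⟩
      simp only [decide_eq_true_eq]
      omega

theorem isTab_delta_iff {k M : ℕ} (hk : 1 ≤ k) {T : List ℕ} :
    IsTab k M (delta k) T ↔ T = List.replicate M 0 := by
  constructor
  · rintro ⟨h1, -, h2, h3⟩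
    refine List.eq_replicate_iff.2 ⟨h1, fun t ht => ?_⟩
    by_contra h0
    have := h3 ⟨t - 1, by have := h2 t ht; omega⟩
    have hpos := List.count_pos_iff.2 ht
    simp only at this
    rw [show t - 1 + 1 = t by omega] at this
    omega
  · rintro rfl
    refine ⟨by simp, isLatticeWord_replicate_zero M, fun t ht => ?_, fun i => ?_⟩
    · rw [List.eq_of_mem_replicate ht]
      exact hk
    · simp [List.count_replicate]

theorem nonempty_arcCode_equiv_walkTo {k : ℕ} (hk : 2 ≤ k) (M : ℕ) :
    Nonempty ({x // ArcCode k M x} ≃ WalkTo k M (delta k)) := by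
  obtain ⟨e⟩ := nonempty_tabPair_equiv_walkTo hk M (delta k)
  have h (x : ℕ → ℕ) : ArcCode k M x ↔ GoodTab k M (List.replicate M 0) x ∧
      ∀ j, j = 0 ∨ M < j → x j = 0 := by
    rw [arcCode_iff (by omega), goodWord_iff_goodTab (by omega) (by simp) List.nodup_nil, tableau]
  have e' : {x // ArcCode k M x} ≃ TabPair k M (delta k) :=
    { toFun := fun x =>
        ⟨(List.replicate M 0, x.1), (isTab_delta_iff (by omega)).2 rfl, (h _).1 x.2⟩
      invFun := fun y => ⟨y.1.2, (h _).2 ((isTab_delta_iff (by omega)).1 y.2.1 ▸ y.2.2)⟩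
      left_inv := fun x => rfl
      right_inv := fun y => Subtype.ext (Prod.ext ((isTab_delta_iff (by omega)).1 y.2.1).symm rfl) }
  exact ⟨e'.trans e⟩

section Partition

variable {N : ℕ} {P : Finpartition (univ : Finset (Fin N))}

theorem mem_block_iff_part_eq {B : Finset (Fin N)} (hB : B ∈ P.parts) {a c : Fin N} (ha : a ∈ B) :
    c ∈ B ↔ P.part c = P.part a := by
  rw [P.part_eq_of_mem hB ha, P.part_eq_iff_mem hB]

theorem isArc_iff {a b : Fin N} : IsArc P a b ↔
    a < b ∧ P.part b = P.part a ∧ ∀ c, P.part c = P.part a → ¬(a < c ∧ c < b) := by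
  refine and_congr_right fun _ => ⟨?_, fun ⟨h, hn⟩ => ?_⟩
  · rintro ⟨B, hB, ha, hb, hn⟩
    exact ⟨(mem_block_iff_part_eq hB ha).1 hb,
      fun c hc => hn c ((mem_block_iff_part_eq hB ha).2 hc)⟩
  · have hP := P.part_mem.2 (mem_univ a)
    have ha := P.mem_part (mem_univ a)
    exact ⟨_, hP, ha, (mem_block_iff_part_eq hP ha).2 h,
      fun c hc => hn c ((mem_block_iff_part_eq hP ha).1 hc)⟩

theorem isArc_left_unique {a b c : Fin N} (ha : IsArc P a c) (hb : IsArc P b c) : a = b := by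
  rw [isArc_iff] at ha hb
  have hab := ha.2.1.symm.trans hb.2.1
  rcases lt_trichotomy a b with h | h | h
  · exact absurd ⟨h, hb.1⟩ (ha.2.2 _ hab.symm)
  · exact h
  · exact absurd ⟨h, ha.1⟩ (hb.2.2 _ hab)

theorem eqvGen_isArc_of_lt {a b : Fin N} (h : P.part b = P.part a) (hab : a < b) :
    Relation.EqvGen (IsArc P) a b := by
  induction hd : (b - a : ℕ) using Nat.strong_induction_on generalizing a b with
  | _ d ih =>
    by_cases hc : IsArc P a b
    · exact .rel _ _ hc
    · simp only [isArc_iff, hab, h, true_and] at hc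
      push Not at hc
      obtain ⟨c, hc, hac, hcb⟩ := hc
      exact (ih (c - a) (by omega) hc hac rfl).trans _ _ _
        (ih (b - c) (by omega) (h.trans hc.symm) hcb rfl)

/-- Two elements lie in a common block iff they are connected by arcs. -/
theorem part_eq_part_iff_eqvGen {a b : Fin N} :
    P.part a = P.part b ↔ Relation.EqvGen (IsArc P) a b := by
  constructor
  · intro h
    rcases lt_trichotomy a b with hab | rfl | hab
    · exact eqvGen_isArc_of_lt h.symm hab
    · exact .refl _
    · exact (eqvGen_isArc_of_lt h hab).symm
  · intro h
    induction h with
    | rel a b h => exact (isArc_iff.1 h).2.1.symm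
    | refl => rfl
    | symm _ _ _ ih => exact ih.symm
    | trans _ _ _ _ _ ih ih' => exact ih.trans ih'

theorem eq_of_part_eq_part_iff {Q : Finpartition (univ : Finset (Fin N))}
    (h : ∀ a b, P.part a = P.part b ↔ Q.part a = Q.part b) : P = Q := by
  have hPQ : ∀ a, P.part a = Q.part a := fun a => by
    ext c
    rw [P.mem_part_iff_part_eq_part (mem_univ _) (mem_univ _),
      Q.mem_part_iff_part_eq_part (mem_univ _) (mem_univ _), h]
  ext B
  constructor <;> intro hB
  · obtain ⟨a, ha⟩ := P.nonempty_of_mem_parts hB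
    rw [← P.part_eq_of_mem hB ha, hPQ]
    exact Q.part_mem.2 (mem_univ a)
  · obtain ⟨a, ha⟩ := Q.nonempty_of_mem_parts hB
    rw [← Q.part_eq_of_mem hB ha, ← hPQ]
    exact P.part_mem.2 (mem_univ a)

theorem eq_of_isArc_iff {Q : Finpartition (univ : Finset (Fin N))}
    (h : ∀ a b, IsArc P a b ↔ IsArc Q a b) : P = Q := by
  have : IsArc P = IsArc Q := by
    funext a b
    exact propext (h a b)
  exact eq_of_part_eq_part_iff fun a b => by
    rw [part_eq_part_iff_eqvGen, part_eq_part_iff_eqvGen, this]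

theorem twoRegular_iff : TwoRegular P ↔ ∀ a b, IsArc P a b → (a : ℕ) + 1 < b := by
  constructor
  · rintro h a b ⟨hab, B, hB, ha, hb, -⟩
    have := h B hB a ha b hb hab.ne
    rw [le_abs] at this
    omega
  · intro h B hB a ha b hb hab
    by_contra hlt
    wlog hlt' : a < b generalizing a b
    · exact this b hb a ha hab.symm (by rwa [abs_sub_comm]) (by omega)
    rw [le_abs] at hlt
    have := h a b ⟨hlt', B, hB, ha, hb, fun c _ => by omega⟩
    omega

end Partition

section Reconstruction

variable {α : Type*} {R : α → α → Prop}

theorem reflTransGen_or_of_eqvGen (hl : Relator.LeftUnique R) (hr : Relator.RightUnique R)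
    {a b : α} (h : Relation.EqvGen R a b) :
    Relation.ReflTransGen R a b ∨ Relation.ReflTransGen R b a := by
  induction h with
  | rel _ _ h => exact .inl (.single h)
  | refl _ => exact .inl .refl
  | symm _ _ _ ih => exact ih.symm
  | trans a b c _ _ ih ih' =>
    rcases ih with h1 | h1 <;> rcases ih' with h2 | h2
    · exact .inl (h1.trans h2)
    · have := Relation.ReflTransGen.total_of_right_unique (r := Function.swap R)
        (fun _ _ _ h h' => hl h h') h1.swap h2.swap
      simp only [Relation.reflTransGen_swap] at this
      exact this.symm
    · exact Relation.ReflTransGen.total_of_right_unique hr h1 h2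
    · exact .inr (h2.trans h1)

theorem le_of_reflTransGen [Preorder α] (hlt : ∀ a b, R a b → a < b) {a b : α}
    (h : Relation.ReflTransGen R a b) : a ≤ b := by
  induction h with
  | refl => exact le_rfl
  | tail _ h ih => exact ih.trans (hlt _ _ h).le

theorem exists_isArc_iff {N : ℕ} {R : Fin N → Fin N → Prop} (hl : Relator.LeftUnique R)
    (hr : Relator.RightUnique R) (hlt : ∀ a b, R a b → a < b) :
    ∃ P : Finpartition (univ : Finset (Fin N)), ∀ a b, IsArc P a b ↔ R a b := by
  classical
  refine ⟨Finpartition.ofSetoid (Relation.EqvGen.setoid R), fun a b => ?_⟩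
  have hP : ∀ a b, (Finpartition.ofSetoid (Relation.EqvGen.setoid R)).part b =
      (Finpartition.ofSetoid (Relation.EqvGen.setoid R)).part a ↔ Relation.EqvGen R a b :=
    fun a b => by
      rw [← Finpartition.mem_part_iff_part_eq_part _ (mem_univ _) (mem_univ _),
        Finpartition.mem_part_ofSetoid_iff_rel]
      rfl
  have hle : ∀ {a b}, a ≤ b → Relation.EqvGen R a b → Relation.ReflTransGen R a b := by
    intro a b hab h
    rcases reflTransGen_or_of_eqvGen hl hr h with h | h
    · exact h
    · rw [hab.antisymm (le_of_reflTransGen hlt h)]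
  rw [isArc_iff, hP]
  simp only [hP]
  constructor
  · rintro ⟨hab, h, hn⟩
    rcases (hle hab.le h).cases_tail with rfl | ⟨c, hc, hcb⟩
    · exact absurd hab (lt_irrefl _)
    · rcases (le_of_reflTransGen hlt hc).eq_or_lt with rfl | hac
      · exact hcb
      · exact absurd ⟨hac, hlt _ _ hcb⟩ (hn c (Relation.EqvGen.reflTransGen_le_eqvGen (r := R) _ _ hc))
  · intro h
    refine ⟨hlt _ _ h, .rel _ _ h, fun c hc ⟨hac, hcb⟩ => ?_⟩
    rcases (hle hac.le hc).cases_head with rfl | ⟨d, had, hdc⟩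
    · exact lt_irrefl _ hac
    · obtain rfl := hr h had
      exact (le_of_reflTransGen hlt hdc).not_gt hcb

end Reconstruction

/-- `x` encodes the arcs of `P`: `x j = i + 1` iff `(i, j)` is an arc. -/
def Encodes {M : ℕ} (P : Finpartition (univ : Finset (Fin (M + 1)))) (x : ℕ → ℕ) : Prop :=
  (∀ j, j = 0 ∨ M < j → x j = 0) ∧ (∀ j, x j ≤ j) ∧
    ∀ i j : Fin (M + 1), IsArc P i j ↔ x j = i + 1

theorem Encodes.unique {M : ℕ} {P : Finpartition (univ : Finset (Fin (M + 1)))} {x y : ℕ → ℕ}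
    (hx : Encodes P x) (hy : Encodes P y) : x = y := by
  have key : ∀ {x y : ℕ → ℕ}, Encodes P x → Encodes P y → ∀ j, x j ≠ 0 → x j = y j := by
    intro x y hx hy j hj
    have hjM : j < M + 1 := by
      by_contra h
      exact hj (hx.1 j (by omega))
    have hle := hx.2.1 j
    have := (hx.2.2 ⟨x j - 1, by omega⟩ ⟨j, hjM⟩).2 (by simp only; omega)
    have := (hy.2.2 _ _).1 this
    simp only at this
    omega
  funext j
  by_cases hj : x j = 0
  · by_contra h
    exact h (key hy hx j (by omega)).symm
  · exact key hx hy j hj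

theorem exists_encodes {M : ℕ} (P : Finpartition (univ : Finset (Fin (M + 1)))) :
    ∃ x, Encodes P x := by
  classical
  let x : ℕ → ℕ := fun j =>
    if h : ∃ (i : Fin (M + 1)) (hj : j < M + 1), IsArc P i ⟨j, hj⟩ then h.choose + 1 else 0
  have hx : ∀ (i j : Fin (M + 1)), IsArc P i j → x j = i + 1 := fun i j h => by
    have h' : ∃ (i : Fin (M + 1)) (hj : (j : ℕ) < M + 1), IsArc P i ⟨j, hj⟩ := ⟨i, j.2, h⟩
    obtain ⟨_, h2⟩ := h'.choose_spec
    simp only [x, dif_pos h', isArc_left_unique h2 h]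
  have hx' : ∀ j, x j ≠ 0 → ∃ (i : Fin (M + 1)) (hj : j < M + 1), IsArc P i ⟨j, hj⟩ :=
    fun j h => by
      by_contra h'
      exact h (dif_neg h')
  refine ⟨x, fun j hj => ?_, fun j => ?_, fun i j => ⟨hx i j, fun h => ?_⟩⟩
  · by_contra h
    obtain ⟨i, hj', ha⟩ := hx' j h
    have : (i : ℕ) < j := ha.1
    omega
  · by_cases h : x j = 0
    · omega
    · obtain ⟨i, hj', ha⟩ := hx' j h
      have h1 : (i : ℕ) < j := ha.1
      have := hx _ _ ha
      simp only at this
      omega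
  · obtain ⟨i', hj', ha⟩ := hx' j (by omega)
    have := hx _ _ ha
    simp only at this
    rwa [show i = i' from Fin.ext (by omega)]

theorem ArcCode.exists_encodes {k M : ℕ} {x : ℕ → ℕ} (h : ArcCode k M x) :
    ∃ P : Finpartition (univ : Finset (Fin (M + 1))), Encodes P x := by
  obtain ⟨h1, h2, h3, -⟩ := h
  have hle : ∀ j, x j ≤ j := fun j => by
    by_cases hj : x j = 0
    · omega
    · exact (h2 j hj).le
  obtain ⟨P, hP⟩ := exists_isArc_iff (R := fun i j : Fin (M + 1) => x j = i + 1)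
    (fun a b c h h' => Fin.ext (by omega))
    (fun a b c h h' => Fin.ext (h3 _ _ (by omega) (by omega)))
    (fun a b h => by have := hle b; omega)
  exact ⟨P, h1, hle, hP⟩

theorem Encodes.arcCode_iff {k M : ℕ} {P : Finpartition (univ : Finset (Fin (M + 1)))} {x : ℕ → ℕ}
    (h : Encodes P x) : ArcCode k M x ↔ ¬PartitionHasKCrossing k P ∧ TwoRegular P := by
  obtain ⟨h1, hle, hP⟩ := h
  have arc : ∀ j, x j ≠ 0 → ∃ (i : Fin (M + 1)) (hj : j < M + 1), x j = i + 1 ∧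
      IsArc P i ⟨j, hj⟩ := by
    intro j hj
    have hjM : j < M + 1 := by
      by_contra h
      exact hj (h1 j (by omega))
    have hlej := hle j
    refine ⟨⟨x j - 1, by omega⟩, hjM, by simp only; omega, (hP _ _).2 (by simp only; omega)⟩
  have hinj : ∀ i j, x i = x j → x i ≠ 0 → i = j := by
    intro i j hij hi
    obtain ⟨a, hi', ea, ha⟩ := arc i hi
    obtain ⟨b, hj', eb, hb⟩ := arc j (hij ▸ hi)
    obtain rfl : a = b := Fin.ext (by omega)
    rw [isArc_iff] at ha hb
    rcases lt_trichotomy i j with h | h | h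
    · exact absurd ⟨ha.1, h⟩ (hb.2.2 _ ha.2.1)
    · exact h
    · exact absurd ⟨hb.1, h⟩ (ha.2.2 _ hb.2.1)
  have hreg : TwoRegular P ↔ ∀ j, x j ≠ 0 → x j < j := by
    rw [twoRegular_iff]
    constructor
    · intro h j hj
      obtain ⟨a, hj', ea, ha⟩ := arc j hj
      rw [ea]
      exact h _ _ ha
    · intro h a b hab
      have := (hP a b).1 hab
      have := h b (by omega)
      omega
  have hcross : PartitionHasKCrossing k P ↔ ∃ jj : Fin k → ℕ, StrictMono jj ∧
      StrictMono (x ∘ jj) ∧ ∀ m m', 0 < x (jj m) ∧ x (jj m) ≤ jj m' := by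
    constructor
    · rintro ⟨ii, jj, ha, hi, hj, hij⟩
      have hx : ∀ m, x (jj m) = ii m + 1 := fun m => (hP _ _).1 (ha m)
      refine ⟨fun m => jj m, fun m m' h => hj h, fun m m' h => ?_, fun m m' => ?_⟩
      · have : (ii m : ℕ) < ii m' := hi h
        simp only [Function.comp_apply, hx]
        omega
      · have : (ii m : ℕ) < jj m' := hij m m'
        simp only [hx]
        omega
    · rintro ⟨jj, hj, hx, hb⟩
      choose ii hjj hii ha using fun m => arc (jj m) (hb m m).1.ne'
      refine ⟨ii, fun m => ⟨jj m, hjj m⟩, ha, fun m m' h => ?_, fun m m' h => hj h,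
        fun m m' => ?_⟩
      · have := hx h
        simp only [Function.comp_apply, hii] at this
        exact Fin.lt_def.2 (by omega)
      · have := (hb m m').2
        rw [hii] at this
        exact Fin.lt_def.2 this
  rw [hreg, hcross, ArcCode]
  exact ⟨fun h => ⟨h.2.2.2, h.2.1⟩, fun h => ⟨h1, h.2, hinj, h.1⟩⟩

theorem nonempty_partition_equiv_arcCode (k M : ℕ) :
    Nonempty ({P : Finpartition (univ : Finset (Fin (M + 1))) //
      ¬PartitionHasKCrossing k P ∧ TwoRegular P} ≃ {x // ArcCode k M x}) := by
  choose f hf using fun P => exists_encodes (M := M) P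
  refine ⟨Equiv.ofBijective (fun P => ⟨f P.1, (hf P.1).arcCode_iff.2 P.2⟩)
    ⟨fun P Q h => Subtype.ext ?_, fun ⟨x, hx⟩ => ?_⟩⟩
  · have e : f P.1 = f Q.1 := congrArg Subtype.val h
    refine eq_of_isArc_iff fun a b => ?_
    rw [(hf P.1).2.2, (hf Q.1).2.2, e]
  · obtain ⟨P, hP⟩ := hx.exists_encodes
    exact ⟨⟨P, hP.arcCode_iff.1 hx⟩, Subtype.ext ((hf P).unique hP)⟩

end BraidWalk

/-- the number of `2`-regular, `k`-noncrossing partitions of `[N]`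
equals the number of loop-free `ℬ_{W_{k-1}}`-walks of length `2(N-1)` from `δ`
to `δ`. -/
theorem twoRegular_partitions_eq_loopFree_BWalks (k N : ℕ) (hk : 3 ≤ k) (hN : 1 ≤ N) :
    Nat.card {P : Finpartition (Finset.univ : Finset (Fin N)) //
        ¬ PartitionHasKCrossing k P ∧ TwoRegular P} =
    Nat.card {v : Fin (2 * (N - 1) + 1) → Pt k //
        IsBWalk (inW (k := k)) (2 * (N - 1)) v ∧ LoopFree v ∧
        v (Fin.last (2 * (N - 1))) = delta k} := by
  obtain ⟨M, rfl⟩ : ∃ M, N = M + 1 := ⟨N - 1, by omega⟩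
  obtain ⟨e⟩ := BraidWalk.nonempty_partition_equiv_arcCode k M
  obtain ⟨e'⟩ := BraidWalk.nonempty_arcCode_equiv_walkTo (by omega : 2 ≤ k) M
  exact Nat.card_congr (e.trans e')
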